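/- arXiv:2302.05824 — 2 statements merged into one kernel-verified Lean document; each statement's English description precedes it below -/
import Mathlib

section
/- For every α,β>-1 there exists a constant C₀>0 such that for all integers n≥0 and all x∈(-1,1), |P_n^{(α,β)}(x)| ≤ C₀ (n+1)^{-1/2} (1-x)^{-max{α/2+1/4, 0}} (1+x)^{-max{β/2+1/4, 0}}. -/
open MeasureTheory Set

/-- Jacobi polynomial via Rodrigues' formula. -/
noncomputable def jacobiP (a b : ℝ) (n : ℕ) (x : ℝ) : ℝ :=
  ((-1 : ℝ) ^ n / (2 ^ n * (n.factorial : ℝ))) * (1 - x) ^ (-a) * (1 + x) ^ (-b) *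
    iteratedDeriv n (fun y => (1 - y) ^ ((n : ℝ) + a) * (1 + y) ^ ((n : ℝ) + b)) x

/-- Coefficients of the Jacobi polynomial in the Bernstein-type basis. -/
noncomputable def jB (a b : ℝ) (n j : ℕ) : ℝ :=
  (-1) ^ j * (n.choose j : ℝ) * (descPochhammer ℝ (n - j)).eval ((n : ℝ) + a) *
    (descPochhammer ℝ j).eval ((n : ℝ) + b) / (n.factorial : ℝ)

/-- The Jacobi polynomial in the variable `t = (1 - x) / 2`. -/
noncomputable def jPoly (a b : ℝ) (n : ℕ) : Polynomial ℝ :=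
  ∑ j ∈ Finset.range (n + 1), Polynomial.C (jB a b n j) *
    (Polynomial.X ^ j * (1 - Polynomial.X) ^ (n - j))

lemma jacobiP_symm (a b : ℝ) (n : ℕ) (x : ℝ) :
    |jacobiP a b n x| = |jacobiP b a n (-x)| := by
  have h := iteratedDeriv_comp_neg n
    (fun y : ℝ => (1 - y) ^ ((n : ℝ) + b) * (1 + y) ^ ((n : ℝ) + a)) x
  have h2 : (fun y : ℝ => (1 - y) ^ ((n : ℝ) + a) * (1 + y) ^ ((n : ℝ) + b)) =
      fun y : ℝ => (1 - -y) ^ ((n : ℝ) + b) * (1 + -y) ^ ((n : ℝ) + a) := by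
    funext y
    rw [sub_neg_eq_add, ← sub_eq_add_neg, mul_comm]
  unfold jacobiP
  rw [h2, h, smul_eq_mul]
  simp only [abs_mul, abs_pow, abs_neg, abs_one, one_pow, one_mul, sub_neg_eq_add,
    ← sub_eq_add_neg]
  ring

lemma jacobiP_eq (a b : ℝ) (n : ℕ) (x : ℝ) (hx : x ∈ Set.Ioo (-1 : ℝ) 1) :
    jacobiP a b n x = (jPoly a b n).eval ((1 - x) / 2) := by
  obtain ⟨h1, h2⟩ := hx
  have hp : 0 < 1 + x := by linarith
  have hm : 0 < 1 - x := by linarith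
  have hf : ContDiffAt ℝ n (fun y : ℝ => (1 + y) ^ ((n : ℝ) + b)) x :=
    ContDiffAt.rpow_const_of_ne (by fun_prop) hp.ne'
  have hg : ContDiffAt ℝ n (fun y : ℝ => (1 - y) ^ ((n : ℝ) + a)) x :=
    ContDiffAt.rpow_const_of_ne (by fun_prop) hm.ne'
  have e1 : (fun y : ℝ => (1 - y) ^ ((n : ℝ) + a) * (1 + y) ^ ((n : ℝ) + b)) =
      (fun y : ℝ => (1 + y) ^ ((n : ℝ) + b)) * (fun y : ℝ => (1 - y) ^ ((n : ℝ) + a)) := by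
    funext y
    simp [mul_comm]
  unfold jacobiP jPoly
  rw [e1, iteratedDeriv_mul hf hg, Polynomial.eval_finsetSum, Finset.mul_sum]
  refine Finset.sum_congr rfl fun j hj => ?_
  have hj' : j ≤ n := by simpa [Nat.lt_succ_iff] using hj
  have d1 : iteratedDeriv j (fun y : ℝ => (1 + y) ^ ((n : ℝ) + b)) x =
      (descPochhammer ℝ j).eval ((n : ℝ) + b) * (1 + x) ^ ((n : ℝ) + b - j) := by
    rw [iteratedDeriv_comp_const_add j (fun y : ℝ => y ^ ((n : ℝ) + b)) 1]
    simp only [iteratedDeriv_eq_iterate]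
    exact Real.iter_deriv_rpow_const _ _ _
  have d2 : iteratedDeriv (n - j) (fun y : ℝ => (1 - y) ^ ((n : ℝ) + a)) x =
      (-1) ^ (n - j) *
      ((descPochhammer ℝ (n - j)).eval ((n : ℝ) + a) * (1 - x) ^ (j + a)) := by
    rw [iteratedDeriv_comp_const_sub (n - j) (fun y : ℝ => y ^ ((n : ℝ) + a)) 1]
    simp only [iteratedDeriv_eq_iterate, smul_eq_mul]
    rw [Real.iter_deriv_rpow_const]
    congr 3
    rw [Nat.cast_sub hj']
    ring
  have s1 : (1 + x) ^ ((n : ℝ) + b - j) = (1 + x) ^ b * (1 + x) ^ (n - j) := by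
    rw [← Real.rpow_natCast, ← Real.rpow_add hp, Nat.cast_sub hj']
    congr 1
    ring
  have s2 : (1 - x) ^ ((j : ℝ) + a) = (1 - x) ^ a * (1 - x) ^ j := by
    rw [← Real.rpow_natCast, ← Real.rpow_add hm]
    congr 1
    ring
  rw [d1, d2, s1, s2, Real.rpow_neg hm.le, Real.rpow_neg hp.le]
  have q1 : (1 - x) ^ a ≠ 0 := (Real.rpow_pos_of_pos hm a).ne'
  have q2 : (1 + x) ^ b ≠ 0 := (Real.rpow_pos_of_pos hp b).ne'
  have q3 : (n.factorial : ℝ) ≠ 0 := by exact_mod_cast n.factorial_ne_zero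
  simp only [Polynomial.eval_mul, Polynomial.eval_C, Polynomial.eval_pow, Polynomial.eval_sub,
    Polynomial.eval_one, Polynomial.eval_X]
  rw [show 1 - (1 - x) / 2 = (1 + x) / 2 by ring, div_pow, div_pow]
  obtain ⟨m, rfl⟩ := Nat.exists_eq_add_of_le hj'
  simp only [Nat.add_sub_cancel_left, jB]
  have q4 : ((-1 : ℝ) ^ m) * (-1) ^ m = 1 := by rw [← mul_pow]; norm_num
  field_simp
  rw [pow_add (2 : ℝ), pow_add (-1 : ℝ)]
  linear_combination ((-1 : ℝ) ^ j * (2 ^ j * 2 ^ m * ((j + m).choose j : ℝ) *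
    Polynomial.eval ((j + m : ℕ) + b) (descPochhammer ℝ j) *
    Polynomial.eval ((j + m : ℕ) + a) (descPochhammer ℝ m))) * q4

lemma jB_rec (a b : ℝ) (n j : ℕ) (hj : j < n) :
    ((n : ℝ) - j) * (n - j + b) * jB a b n j =
      -((j + 1) * (j + 1 + a)) * jB a b n (j + 1) := by
  obtain ⟨m, rfl⟩ := Nat.exists_eq_add_of_lt hj
  have e1 : j + m + 1 - j = m + 1 := by omega
  have e2 : j + m + 1 - (j + 1) = m := by omega
  have hc : (((j + m + 1).choose (j + 1) : ℕ) : ℝ) * (j + 1) = (j + m + 1).choose j * (m + 1) := by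
    have := Nat.choose_succ_right_eq (j + m + 1) j
    rw [e1] at this
    exact_mod_cast this
  simp only [jB, e1, e2, descPochhammer_succ_eval, pow_succ]
  have q3 : ((j + m + 1).factorial : ℝ) ≠ 0 := by exact_mod_cast (j + m + 1).factorial_ne_zero
  field_simp
  push_cast
  ring_nf
  ring_nf at hc
  grind

lemma e_deriv (j m : ℕ) :
    (Polynomial.X * (1 - Polynomial.X)) * Polynomial.derivative
      ((Polynomial.X : Polynomial ℝ) ^ j * (1 - Polynomial.X) ^ m) =
    ((j : Polynomial ℝ) - ((j + m : ℕ) : Polynomial ℝ) * Polynomial.X) *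
      (Polynomial.X ^ j * (1 - Polynomial.X) ^ m) := by
  rcases j with _ | j <;> rcases m with _ | m <;>
    simp [Polynomial.derivative_mul, Polynomial.derivative_pow] <;> ring

lemma jPoly_ode_aux (a b : ℝ) (n j : ℕ) (hj : j ≤ n) (e : Polynomial ℝ)
    (he : e = Polynomial.X ^ j * (1 - Polynomial.X) ^ (n - j)) :
    (Polynomial.X * (1 - Polynomial.X)) * (Polynomial.X * (1 - Polynomial.X) *
      Polynomial.derivative (Polynomial.derivative e) +
      (Polynomial.C (a + 1) - Polynomial.C (a + b + 2) * Polynomial.X) *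
        Polynomial.derivative e + Polynomial.C ((n : ℝ) * (n + a + b + 1)) * e) =
    (Polynomial.C ((j : ℝ) * (j + a)) * (1 - Polynomial.X) +
      Polynomial.C (((n : ℝ) - j) * (n - j + b)) * Polynomial.X) * e := by
  have h1 : (Polynomial.X * (1 - Polynomial.X)) * Polynomial.derivative e =
    ((j : Polynomial ℝ) - (n : Polynomial ℝ) * Polynomial.X) * e := by
    have := e_deriv j (n - j)
    rwa [← he, Nat.add_sub_cancel' hj] at this
  have h2 := congrArg Polynomial.derivative h1
  simp only [Polynomial.derivative_mul, Polynomial.derivative_sub, Polynomial.derivative_X,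
    Polynomial.derivative_one, Polynomial.derivative_natCast] at h2
  simp only [map_mul, map_add, map_sub, Polynomial.C_1, Polynomial.C_ofNat, map_natCast]
  linear_combination (Polynomial.X * (1 - Polynomial.X)) * h2 +
    ((j : Polynomial ℝ) - (n : Polynomial ℝ) * Polynomial.X - (1 - 2 * Polynomial.X) +
      Polynomial.C a + 1 - (Polynomial.C a + Polynomial.C b + 2) * Polynomial.X) * h1

lemma jPoly_ode (a b : ℝ) (n : ℕ) :
    Polynomial.X * (1 - Polynomial.X) *
      Polynomial.derivative (Polynomial.derivative (jPoly a b n)) +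
      (Polynomial.C (a + 1) - Polynomial.C (a + b + 2) * Polynomial.X) *
        Polynomial.derivative (jPoly a b n) +
      Polynomial.C ((n : ℝ) * (n + a + b + 1)) * jPoly a b n = 0 := by
  have hne : (Polynomial.X * (1 - Polynomial.X) : Polynomial ℝ) ≠ 0 := by
    intro h
    have := congrArg (Polynomial.eval 2) h
    norm_num at this
  refine mul_left_cancel₀ hne ?_
  rw [mul_zero]
  set V : ℕ → Polynomial ℝ := fun j => if j ≤ n then
    Polynomial.C ((j : ℝ) * (j + a) * jB a b n j) * (1 - Polynomial.X) *
      (Polynomial.X ^ j * (1 - Polynomial.X) ^ (n - j)) else 0 with hV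
  have key : ∀ j ∈ Finset.range (n + 1),
      (Polynomial.X * (1 - Polynomial.X)) * (Polynomial.X * (1 - Polynomial.X) *
      Polynomial.derivative (Polynomial.derivative (Polynomial.C (jB a b n j) *
        (Polynomial.X ^ j * (1 - Polynomial.X) ^ (n - j)))) +
      (Polynomial.C (a + 1) - Polynomial.C (a + b + 2) * Polynomial.X) *
        Polynomial.derivative (Polynomial.C (jB a b n j) *
        (Polynomial.X ^ j * (1 - Polynomial.X) ^ (n - j))) +
        Polynomial.C ((n : ℝ) * (n + a + b + 1)) * (Polynomial.C (jB a b n j) *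
        (Polynomial.X ^ j * (1 - Polynomial.X) ^ (n - j)))) = V j - V (j + 1) := by
    intro j hj
    have hj' : j ≤ n := by simpa [Nat.lt_succ_iff] using hj
    have h := jPoly_ode_aux a b n j hj' _ rfl
    simp only [Polynomial.derivative_C_mul]
    have hV1 : V j = Polynomial.C ((j : ℝ) * (j + a) * jB a b n j) * (1 - Polynomial.X) *
      (Polynomial.X ^ j * (1 - Polynomial.X) ^ (n - j)) := by simp [hV, hj']
    have hV2 : V (j + 1) = - (Polynomial.C (((n : ℝ) - j) * (n - j + b) * jB a b n j) *
        Polynomial.X * (Polynomial.X ^ j * (1 - Polynomial.X) ^ (n - j))) := by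
      rcases hj'.lt_or_eq with h3 | h3
      · have h4 : j + 1 ≤ n := h3
        rw [jB_rec a b n j h3]
        have h5 : n - j = n - (j + 1) + 1 := by omega
        simp only [hV, h4, if_true, h5]
        push_cast
        simp only [Polynomial.C_mul, Polynomial.C_neg, Polynomial.C_add]
        ring
      · subst h3
        simp [hV]
    rw [hV1, hV2]
    simp only [Polynomial.C_mul] at h ⊢
    linear_combination Polynomial.C (jB a b n j) * h
  have hs := Finset.sum_congr rfl key
  rw [Finset.sum_range_sub'] at hs
  have : V 0 - V (n + 1) = 0 := by simp [hV]
  rw [this] at hs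
  rw [← hs]
  unfold jPoly
  simp only [Polynomial.derivative_sum, Finset.mul_sum, ← Finset.sum_add_distrib]

lemma jB_zero_bound (a b : ℝ) (ha : -1 < a) (n : ℕ) :
    0 ≤ jB a b n 0 ∧ jB a b n 0 ≤ Real.exp |a| * ((n : ℝ) + 1) ^ a := by
  have h0 : ∀ n : ℕ, jB a b n 0 =
      (descPochhammer ℝ n).eval ((n : ℝ) + a) / (n.factorial : ℝ) := by
    intro n
    simp [jB]
  have hind : ∀ n : ℕ, 0 ≤ (descPochhammer ℝ n).eval ((n : ℝ) + a) / (n.factorial : ℝ) ∧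
      (descPochhammer ℝ n).eval ((n : ℝ) + a) / (n.factorial : ℝ) ≤
        Real.exp (a * (harmonic n : ℝ)) := by
    intro n
    induction n with
    | zero => simp
    | succ n ih =>
      have e : (descPochhammer ℝ (n + 1)).eval (((n + 1 : ℕ) : ℝ) + a) /
          ((n + 1).factorial : ℝ) = (1 + a / (n + 1)) *
          ((descPochhammer ℝ n).eval ((n : ℝ) + a) / (n.factorial : ℝ)) := by
        rw [descPochhammer_succ_left, Nat.factorial_succ]
        have q3 : (n.factorial : ℝ) ≠ 0 := by exact_mod_cast n.factorial_ne_zero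
        have q4 : (n : ℝ) + 1 ≠ 0 := by positivity
        simp only [Polynomial.eval_mul, Polynomial.eval_X, Polynomial.eval_comp,
          Polynomial.eval_sub, Polynomial.eval_one]
        push_cast
        rw [show (n : ℝ) + 1 + a - 1 = n + a by ring]
        field_simp
      have hn : (0 : ℝ) < n + 1 := by positivity
      have h1 : 0 ≤ 1 + a / (n + 1) := by
        have hnn : (0 : ℝ) ≤ n := by positivity
        have h2 : 1 + a / (n + 1) = (n + 1 + a) / ((n : ℝ) + 1) := by field_simp
        rw [h2]
        apply div_nonneg <;> linarith
      rw [e]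
      refine ⟨mul_nonneg h1 ih.1, ?_⟩
      rw [harmonic_succ]
      push_cast
      rw [mul_add, Real.exp_add, mul_comm (Real.exp (a * _))]
      refine mul_le_mul ?_ ih.2 ih.1 (Real.exp_pos _).le
      have := Real.add_one_le_exp (a * ((n : ℝ) + 1)⁻¹)
      rw [div_eq_mul_inv]
      linarith
  rw [h0]
  refine ⟨(hind n).1, (hind n).2.trans ?_⟩
  have hn : (0 : ℝ) < n + 1 := by positivity
  rw [Real.rpow_def_of_pos hn, ← Real.exp_add, Real.exp_le_exp]
  have l1 := log_add_one_le_harmonic n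
  have l2 := harmonic_le_one_add_log n
  push_cast at l1
  rcases le_total 0 a with h | h
  · rw [abs_of_nonneg h]
    have l3 : Real.log n ≤ Real.log (n + 1) := by
      rcases Nat.eq_zero_or_pos n with h5 | h5
      · simp [h5]
      · exact Real.log_le_log (by exact_mod_cast h5) (by linarith)
    nlinarith
  · have : 0 ≤ |a| := abs_nonneg a
    nlinarith

lemma jPoly_coeff_zero (a b : ℝ) (n : ℕ) : (jPoly a b n).coeff 0 = jB a b n 0 := by
  rw [Polynomial.coeff_zero_eq_eval_zero, jPoly, Polynomial.eval_finsetSum,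
    Finset.sum_eq_single 0]
  · simp
  · intro j _ hj
    simp [hj]
  · simp

lemma jPoly_coeff_rec (a b : ℝ) (n k : ℕ) :
    ((k : ℝ) + 1) * (k + a + 1) * (jPoly a b n).coeff (k + 1) =
      ((k : ℝ) * (k + (a + b + 1)) - n * (n + a + b + 1)) * (jPoly a b n).coeff k := by
  have h := congrArg (fun q => Polynomial.coeff q k) (jPoly_ode a b n)
  generalize jPoly a b n = p at h ⊢
  have e : Polynomial.X * (1 - Polynomial.X) *
      Polynomial.derivative (Polynomial.derivative p) +
      (Polynomial.C (a + 1) - Polynomial.C (a + b + 2) * Polynomial.X) *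
        Polynomial.derivative p +
      Polynomial.C ((n : ℝ) * (n + a + b + 1)) * p =
      Polynomial.X * Polynomial.derivative (Polynomial.derivative p)
      - Polynomial.X * (Polynomial.X * Polynomial.derivative (Polynomial.derivative p)) +
      Polynomial.C (a + 1) * Polynomial.derivative p
      - Polynomial.C (a + b + 2) * (Polynomial.X * Polynomial.derivative p) +
      Polynomial.C ((n : ℝ) * (n + a + b + 1)) * p := by ring
  rw [e] at h
  simp only [Polynomial.coeff_add, Polynomial.coeff_sub, Polynomial.coeff_C_mul,
    Polynomial.coeff_zero] at h
  rcases k with _ | _ | k <;>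
  · simp [Polynomial.coeff_derivative, Polynomial.coeff_X_mul] at h ⊢
    linarith

lemma jPoly_coeff_bound (a b : ℝ) (ha : -1 < a) (hb : -1 < b) (n k : ℕ) :
    |(jPoly a b n).coeff k| * (k.factorial : ℝ) ≤
      (jB a b n 0 / min (a + 1) 1) * ((n : ℝ) * (n + a + b + 1)) ^ k := by
  set lam : ℝ := (n : ℝ) * (n + a + b + 1) with hlam
  set m : ℝ := min (a + 1) 1 with hm
  have hm0 : 0 < m := lt_min (by linarith) one_pos
  have hM := (jB_zero_bound a b ha n).1
  have hlam0 : 0 ≤ lam := by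
    rcases Nat.eq_zero_or_pos n with h | h
    · simp [hlam, h]
    · have : (1 : ℝ) ≤ n := by exact_mod_cast h
      exact mul_nonneg (by linarith) (by linarith)
  have hrec := jPoly_coeff_rec a b n
  have hzero : ∀ k, n < k → (jPoly a b n).coeff k = 0 := by
    intro k hk
    induction k with
    | zero => omega
    | succ k ih =>
      have h1 := hrec k
      have h2 : ((k : ℝ) * (k + (a + b + 1)) - n * (n + a + b + 1)) *
          (jPoly a b n).coeff k = 0 := by
        rcases (Nat.lt_succ_iff.mp hk).lt_or_eq with h | h
        · rw [ih h, mul_zero]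
        · rw [h]; ring
      rw [h2] at h1
      have h3 : (0 : ℝ) ≤ k := by positivity
      have h4 : ((k : ℝ) + 1) * (k + a + 1) ≠ 0 :=
        mul_ne_zero (by positivity) (by linarith)
      exact (mul_eq_zero.mp h1).resolve_left h4
  have hstep : ∀ k : ℕ, ((k : ℝ) + 1) * (k + a + 1) * |(jPoly a b n).coeff (k + 1)| ≤
      lam * |(jPoly a b n).coeff k| := by
    intro k
    rcases lt_or_ge n k with h | h
    · rw [hzero k h, hzero (k + 1) (by omega)]; simp
    · have h3 : (0 : ℝ) ≤ k := by positivity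
      have h1 := congrArg abs (hrec k)
      rw [abs_mul, abs_mul (_ - _), abs_of_nonneg
        (mul_nonneg (by positivity) (by linarith) : 0 ≤ ((k : ℝ) + 1) * (k + a + 1))] at h1
      rw [h1]
      refine mul_le_mul_of_nonneg_right ?_ (abs_nonneg _)
      have h5 : (k : ℝ) ≤ n := by exact_mod_cast h
      have h6 : 0 ≤ (k : ℝ) * (k + (a + b + 1)) := by
        rcases Nat.eq_zero_or_pos k with h | h
        · simp [h]
        · have : (1 : ℝ) ≤ k := by exact_mod_cast h
          exact mul_nonneg (by linarith) (by linarith)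
      have h7 : (k : ℝ) * (k + (a + b + 1)) ≤ lam := by
        rcases h.lt_or_eq with h | h
        · have : (k : ℝ) + 1 ≤ n := by exact_mod_cast h
          rw [hlam]
          nlinarith
        · rw [hlam, h]; linarith
      rw [abs_le]
      constructor <;> linarith
  induction k with
  | zero =>
    rw [jPoly_coeff_zero, abs_of_nonneg hM]
    simp only [Nat.factorial_zero, Nat.cast_one, mul_one, pow_zero]
    rw [le_div_iff₀ hm0]
    exact mul_le_of_le_one_right hM (min_le_right _ _)
  | succ k ih =>
    rcases Nat.eq_zero_or_pos k with h | h
    · subst h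
      have h1 := hstep 0
      rw [jPoly_coeff_zero, abs_of_nonneg hM] at h1
      simp only [Nat.cast_zero, zero_add, one_mul] at h1
      simp only [zero_add, Nat.factorial_one, Nat.cast_one, mul_one, pow_one]
      rw [div_mul_eq_mul_div, le_div_iff₀ hm0]
      have h2 : m ≤ a + 1 := min_le_left _ _
      have := abs_nonneg ((jPoly a b n).coeff 1)
      nlinarith
    · have h0 : (1 : ℝ) ≤ k := by exact_mod_cast h
      have h1 := hstep k
      have h2 : ((k : ℝ) + 1) * |(jPoly a b n).coeff (k + 1)| ≤
          lam * |(jPoly a b n).coeff k| := by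
        refine le_trans ?_ h1
        refine mul_le_mul_of_nonneg_right ?_ (abs_nonneg _)
        nlinarith
      rw [Nat.factorial_succ, pow_succ]
      push_cast
      have hf : (0 : ℝ) ≤ (k.factorial : ℝ) := by positivity
      calc |(jPoly a b n).coeff (k + 1)| * (((k : ℝ) + 1) * (k.factorial : ℝ))
          = (((k : ℝ) + 1) * |(jPoly a b n).coeff (k + 1)|) * (k.factorial : ℝ) := by ring
        _ ≤ (lam * |(jPoly a b n).coeff k|) * (k.factorial : ℝ) :=
            mul_le_mul_of_nonneg_right h2 hf
        _ = lam * (|(jPoly a b n).coeff k| * (k.factorial : ℝ)) := by ring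
        _ ≤ lam * (jB a b n 0 / m * lam ^ k) := mul_le_mul_of_nonneg_left ih hlam0
        _ = _ := by ring

lemma poly_eval_bound (p : Polynomial ℝ) (K lam t : ℝ) (hK : 0 ≤ K) (hl : 0 ≤ lam) (ht : 0 ≤ t)
    (h : ∀ k, |p.coeff k| * (k.factorial : ℝ) ≤ K * lam ^ k) :
    |p.eval t| ≤ K * Real.exp (lam * t) := by
  rw [Polynomial.eval_eq_sum_range]
  refine (Finset.abs_sum_le_sum_abs _ _).trans ?_
  refine le_trans ?_ (mul_le_mul_of_nonneg_left
    (Real.sum_le_exp_of_nonneg (mul_nonneg hl ht) (p.natDegree + 1)) hK)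
  rw [Finset.mul_sum]
  refine Finset.sum_le_sum fun k _ => ?_
  have hf : (0 : ℝ) < (k.factorial : ℝ) := by positivity
  rw [abs_mul, abs_of_nonneg (pow_nonneg ht k), mul_pow]
  rw [← mul_div_assoc, le_div_iff₀ hf]
  have := mul_le_mul_of_nonneg_right (h k) (pow_nonneg ht k)
  linarith

lemma jPoly_series_bound (a b : ℝ) (ha : -1 < a) (hb : -1 < b) (n : ℕ) (t : ℝ) (ht : 0 ≤ t) :
    |(jPoly a b n).eval t| ≤
      (jB a b n 0 / min (a + 1) 1) * Real.exp ((n : ℝ) * (n + a + b + 1) * t) ∧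
    |(Polynomial.derivative (jPoly a b n)).eval t| ≤
      (jB a b n 0 / min (a + 1) 1) * ((n : ℝ) * (n + a + b + 1)) *
        Real.exp ((n : ℝ) * (n + a + b + 1) * t) := by
  have hm0 : 0 < min (a + 1) 1 := lt_min (by linarith) one_pos
  have hM := (jB_zero_bound a b ha n).1
  have hK := div_nonneg hM hm0.le
  have hlam0 : 0 ≤ (n : ℝ) * (n + a + b + 1) := by
    rcases Nat.eq_zero_or_pos n with h | h
    · simp [h]
    · have : (1 : ℝ) ≤ n := by exact_mod_cast h
      exact mul_nonneg (by linarith) (by linarith)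
  have hc := jPoly_coeff_bound a b ha hb n
  refine ⟨poly_eval_bound _ _ _ _ hK hlam0 ht hc,
    poly_eval_bound _ _ _ _ (mul_nonneg hK hlam0) hlam0 ht fun k => ?_⟩
  have := hc (k + 1)
  rw [Nat.factorial_succ, pow_succ] at this
  push_cast at this
  rw [Polynomial.coeff_derivative, abs_mul, abs_of_nonneg (by positivity : (0 : ℝ) ≤ (k : ℝ) + 1)]
  linarith

set_option maxHeartbeats 1000000 in
/-- Modified Sonin energy estimate. -/
lemma energy_bound (a b lam : ℝ) (hlam : 0 < lam) (p q q' : ℝ → ℝ)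
    (hp : ∀ t, HasDerivAt p (q t) t) (hq : ∀ t, HasDerivAt q (q' t) t)
    (hode : ∀ t, t * (1 - t) * q' t + ((a + 1) - (a + b + 2) * t) * q t + lam * p t = 0)
    (kap : ℝ) (hkap : kap = (4 * |a + 1 / 2| + 1) ^ 2)
    (A B : ℝ) (hA : A = 4 * |a + 1 / 2| * (1 / 2 + |b + 1 / 2|)) (hB : B = 4 * |2 * b + 1|)
    (t : ℝ) (ht0 : kap / lam ≤ t) (ht1 : t ≤ 1 / 2) :
    p t ^ 2 ≤ 3 * t ^ (-(a + 1 / 2)) * Real.exp (2 * A + B / 2) * (kap / lam) ^ (a + 1 / 2) *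
      (p (kap / lam) ^ 2 + kap / lam * q (kap / lam) ^ 2 / lam) := by
  set c : ℝ := a + 1 / 2 with hc
  set t0 : ℝ := kap / lam with ht0'
  have hA0 : 0 ≤ A := by rw [hA]; positivity
  have hB0 : 0 ≤ B := by rw [hB]; positivity
  have hk1 : 1 ≤ kap := by rw [hkap]; nlinarith [abs_nonneg c]
  have ht0p : 0 < t0 := by positivity
  have hsl : 0 < Real.sqrt lam := Real.sqrt_pos.mpr hlam
  set S : ℝ → ℝ := fun t => p t ^ 2 + t * (1 - t) * q t ^ 2 / lam with hS
  set H : ℝ → ℝ := fun t => t ^ c * (S t + c * (1 - t) * p t * q t / lam) with hH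
  -- pointwise bounds
  have hb : ∀ t, t0 ≤ t → t ≤ 1 / 2 →
      0 ≤ S t ∧ p t ^ 2 ≤ S t ∧ t * q t ^ 2 / lam ≤ 2 * S t ∧
      |p t * q t| / lam ≤ 2 * S t / Real.sqrt (lam * t) ∧
      4 * |c| + 1 ≤ Real.sqrt (lam * t) := by
    intro t h0 h1
    have htp : 0 < t := by linarith
    have h2 : 0 ≤ t * q t ^ 2 / lam := by positivity
    have h3 : S t = p t ^ 2 + (1 - t) * (t * q t ^ 2 / lam) := by simp only [hS]; ring
    have h4 : p t ^ 2 ≤ S t := by rw [h3]; nlinarith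
    have h5 : t * q t ^ 2 / lam ≤ 2 * S t := by rw [h3]; nlinarith [sq_nonneg (p t)]
    have h6 : 0 ≤ S t := (sq_nonneg _).trans h4
    have hlt : 0 < lam * t := by positivity
    refine ⟨h6, h4, h5, ?_, ?_⟩
    · rw [le_div_iff₀ (Real.sqrt_pos.mpr hlt)]
      refine abs_le_of_sq_le_sq' ?_ (by linarith) |>.2
      rw [mul_pow, Real.sq_sqrt hlt.le, div_pow, sq_abs]
      have : (p t * q t) ^ 2 / lam ^ 2 * (lam * t) = p t ^ 2 * (t * q t ^ 2 / lam) := by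
        field_simp
      rw [this]
      calc p t ^ 2 * (t * q t ^ 2 / lam) ≤ S t * (2 * S t) := mul_le_mul h4 h5 h2 h6
        _ ≤ (2 * S t) ^ 2 := by nlinarith [sq_nonneg (S t)]
    · apply Real.le_sqrt_of_sq_le
      rw [← hkap]
      rw [ht0', div_le_iff₀ hlam] at h0
      linarith
  have hHS : ∀ t, t0 ≤ t → t ≤ 1 / 2 →
      t ^ c * S t ≤ 2 * H t ∧ H t ≤ 3 / 2 * (t ^ c * S t) := by
    intro t h0 h1
    have htp : 0 < t := by linarith
    obtain ⟨b1, b2, b3, b4, b5⟩ := hb t h0 h1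
    have hr : 0 < Real.sqrt (lam * t) := Real.sqrt_pos.mpr (by positivity)
    have hcr : |c * (1 - t) * p t * q t / lam| ≤ S t / 2 := by
      have e : |c * (1 - t) * p t * q t / lam| = |c| * (1 - t) * (|p t * q t| / lam) := by
        rw [abs_div, abs_of_pos hlam, mul_assoc (c * (1 - t)), abs_mul, abs_mul,
          abs_of_nonneg (by linarith : 0 ≤ 1 - t)]
        ring
      rw [e]
      have h2 : |c| * (1 - t) ≤ |c| := by nlinarith [abs_nonneg c]
      calc |c| * (1 - t) * (|p t * q t| / lam) ≤ |c| * (2 * S t / Real.sqrt (lam * t)) :=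
            mul_le_mul h2 b4 (by positivity) (abs_nonneg c)
        _ = (2 * |c| * S t) / Real.sqrt (lam * t) := by ring
        _ ≤ S t / 2 := by
            rw [div_le_iff₀ hr]
            nlinarith [abs_nonneg c]
    have htc : 0 < t ^ c := Real.rpow_pos_of_pos htp c
    have := abs_le.mp hcr
    simp only [hH]
    constructor <;> nlinarith
  have hHd : ∀ t, 0 < t → HasDerivAt H (t ^ c / t * ((2 * b + 1) * t ^ 2 * q t ^ 2 / lam +
      c * (-1 / 2 + (b + 1 / 2) * t) * p t * q t / lam)) t := by
    intro t htp
    have d1 : HasDerivAt (fun t : ℝ => t ^ c) (c * t ^ (c - 1)) t :=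
      Real.hasDerivAt_rpow_const (Or.inl htp.ne')
    have d2 : HasDerivAt (fun t : ℝ => 1 - t) (-1) t := by
      simpa using (hasDerivAt_id t).const_sub 1
    have d3 := ((((hasDerivAt_id t).mul d2).mul ((hq t).pow 2)).div_const lam)
    have d4 := ((((d2.const_mul c).mul (hp t)).mul (hq t)).div_const lam)
    have d5 := d1.mul ((((hp t).pow 2).add d3).add d4)
    refine (d5.congr_deriv ?_).congr_of_eventuallyEq ?_
    · rw [Real.rpow_sub_one htp.ne']
      simp only [Pi.mul_apply, Pi.pow_apply, id, Pi.add_apply]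
      have h := hode t
      have hl := hlam.ne'
      have ht := htp.ne'
      field_simp
      simp only [hc]
      push_cast
      linear_combination 2 * (2 * t * q t + (a + 1 / 2) * p t) * h
    · filter_upwards with x
      simp [hH, hS]
  set E : ℝ → ℝ := fun t => 2 * A / Real.sqrt lam * t ^ (-(1 / 2) : ℝ) - B * t with hE
  have hEd : ∀ t, 0 < t → HasDerivAt E (-(A / (t * Real.sqrt (lam * t))) - B) t := by
    intro t htp
    have d1 : HasDerivAt (fun t : ℝ => t ^ (-(1 / 2) : ℝ)) (-(1 / 2) * t ^ (-(1 / 2) - 1 : ℝ)) t :=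
      Real.hasDerivAt_rpow_const (Or.inl htp.ne')
    have d2 := (d1.const_mul (2 * A / Real.sqrt lam)).sub ((hasDerivAt_id t).const_mul B)
    refine (d2.congr_deriv ?_)
    rw [Real.rpow_sub_one htp.ne', Real.rpow_neg htp.le, ← Real.sqrt_eq_rpow,
      Real.sqrt_mul hlam.le]
    have : 0 < Real.sqrt t := Real.sqrt_pos.mpr htp
    field_simp
  set Φ : ℝ → ℝ := fun t => H t * Real.exp (E t) with hΦ
  have hanti : AntitoneOn Φ (Set.Icc t0 (1 / 2)) := by
    have hd : ∀ t, 0 < t → HasDerivAt Φ _ t := fun t htp => (hHd t htp).mul (hEd t htp).exp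
    apply antitoneOn_of_deriv_nonpos (convex_Icc _ _)
    · intro x hx
      exact (hd x (by linarith [hx.1])).continuousAt.continuousWithinAt
    · intro x hx
      rw [interior_Icc] at hx
      exact (hd x (by linarith [hx.1])).differentiableAt.differentiableWithinAt
    · intro t hx
      rw [interior_Icc] at hx
      have htp : 0 < t := by linarith [hx.1]
      rw [(hd t htp).deriv]
      obtain ⟨b1, b2, b3, b4, b5⟩ := hb t hx.1.le hx.2.le
      obtain ⟨g1, g2⟩ := hHS t hx.1.le hx.2.le
      have hr : 0 < Real.sqrt (lam * t) := Real.sqrt_pos.mpr (by positivity)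
      have htc : 0 < t ^ c := Real.rpow_pos_of_pos htp c
      have k1 : (2 * b + 1) * t ^ 2 * q t ^ 2 / lam ≤ t * (|2 * b + 1| * (2 * S t)) := by
        have : (2 * b + 1) * t ^ 2 * q t ^ 2 / lam = t * ((2 * b + 1) * (t * q t ^ 2 / lam)) := by
          ring
        rw [this]
        refine mul_le_mul_of_nonneg_left ?_ htp.le
        exact mul_le_mul (le_abs_self _) b3 (by positivity) (abs_nonneg _)
      have k2 : c * (-1 / 2 + (b + 1 / 2) * t) * p t * q t / lam ≤
          A / 2 * S t / Real.sqrt (lam * t) := by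
        refine (le_abs_self _).trans ?_
        have e : |c * (-1 / 2 + (b + 1 / 2) * t) * p t * q t / lam| =
            |c| * |-1 / 2 + (b + 1 / 2) * t| * (|p t * q t| / lam) := by
          rw [abs_div, abs_of_pos hlam, mul_assoc (c * _), abs_mul, abs_mul]
          ring
        rw [e]
        have h3 : |-1 / 2 + (b + 1 / 2) * t| ≤ 1 / 2 + |b + 1 / 2| := by
          refine (abs_add_le _ _).trans ?_
          rw [abs_mul, abs_of_pos htp]
          have : |(-1 / 2 : ℝ)| = 1 / 2 := by norm_num [abs_div]
          rw [this]
          have := mul_le_of_le_one_right (abs_nonneg (b + 1 / 2)) (by linarith [hx.2] : t ≤ 1)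
          linarith
        calc _ ≤ |c| * (1 / 2 + |b + 1 / 2|) * (2 * S t / Real.sqrt (lam * t)) := by
              refine mul_le_mul (mul_le_mul_of_nonneg_left h3 (abs_nonneg c)) b4
                (by positivity) (by positivity)
          _ = _ := by rw [hA]; ring
      have k3 : t ^ c / t * ((2 * b + 1) * t ^ 2 * q t ^ 2 / lam +
          c * (-1 / 2 + (b + 1 / 2) * t) * p t * q t / lam) ≤
          H t * (A / (t * Real.sqrt (lam * t)) + B) := by
        calc _ ≤ t ^ c / t * (t * (|2 * b + 1| * (2 * S t)) +
              A / 2 * S t / Real.sqrt (lam * t)) :=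
              mul_le_mul_of_nonneg_left (add_le_add k1 k2) (by positivity)
          _ = (t ^ c * S t) / 2 * (A / (t * Real.sqrt (lam * t)) + B) := by
              rw [hB]
              field_simp
              ring
          _ ≤ _ := by
              refine mul_le_mul_of_nonneg_right (by linarith) (by positivity)
      have hexp := Real.exp_pos (E t)
      have k4 := mul_le_mul_of_nonneg_right k3 hexp.le
      linarith
  have hfin := hanti (Set.left_mem_Icc.mpr (ht0.trans ht1)) ⟨ht0, ht1⟩ ht0
  have htp : 0 < t := by linarith
  obtain ⟨g1, -⟩ := hHS t ht0 ht1
  obtain ⟨-, g2⟩ := hHS t0 le_rfl (ht0.trans ht1)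
  obtain ⟨b1, b2, -, -, -⟩ := hb t ht0 ht1
  have b1' := (hb t0 le_rfl (ht0.trans ht1)).1
  have htc : 0 < t ^ c := Real.rpow_pos_of_pos htp c
  have ht0c : 0 < t0 ^ c := Real.rpow_pos_of_pos ht0p c
  have hE1 : E t0 - E t ≤ 2 * A + B / 2 := by
    have e1 : E t0 ≤ 2 * A := by
      simp only [hE]
      have : 2 * A / Real.sqrt lam * t0 ^ (-(1 / 2) : ℝ) ≤ 2 * A := by
        rw [Real.rpow_neg ht0p.le, ← Real.sqrt_eq_rpow, ← div_eq_mul_inv, div_div,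
          ← Real.sqrt_mul hlam.le, ht0', mul_div_cancel₀ _ hlam.ne']
        apply div_le_self (by linarith)
        exact Real.one_le_sqrt.mpr hk1
      have h2 : 0 ≤ B * t0 := by positivity
      linarith
    have e2 : -(B / 2) ≤ E t := by
      simp only [hE]
      have : 0 ≤ 2 * A / Real.sqrt lam * t ^ (-(1 / 2) : ℝ) := by positivity
      nlinarith
    linarith
  have hHt : H t ≤ H t0 * Real.exp (2 * A + B / 2) := by
    have h1 : H t ≤ H t0 * Real.exp (E t0 - E t) := by
      rw [Real.exp_sub, ← mul_div_assoc, le_div_iff₀ (Real.exp_pos _)]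
      exact hfin
    refine h1.trans (mul_le_mul_of_nonneg_left (Real.exp_le_exp.mpr hE1) ?_)
    have := (hHS t0 le_rfl (ht0.trans ht1)).1
    nlinarith [mul_nonneg ht0c.le b1']
  have hS0 : S t0 ≤ p t0 ^ 2 + t0 * q t0 ^ 2 / lam := by
    simp only [hS]
    have h2 : 0 ≤ t0 * q t0 ^ 2 / lam := by positivity
    have : t0 * (1 - t0) * q t0 ^ 2 / lam = (1 - t0) * (t0 * q t0 ^ 2 / lam) := by ring
    rw [this]
    nlinarith
  have hexp := Real.exp_pos (2 * A + B / 2)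
  have hfin2 : t ^ c * p t ^ 2 ≤ 3 * Real.exp (2 * A + B / 2) * t0 ^ c *
      (p t0 ^ 2 + t0 * q t0 ^ 2 / lam) := by
    calc t ^ c * p t ^ 2 ≤ t ^ c * S t := mul_le_mul_of_nonneg_left b2 htc.le
      _ ≤ 2 * H t := g1
      _ ≤ 2 * (H t0 * Real.exp (2 * A + B / 2)) := by linarith
      _ ≤ 2 * (3 / 2 * (t0 ^ c * S t0) * Real.exp (2 * A + B / 2)) := by gcongr
      _ ≤ 2 * (3 / 2 * (t0 ^ c * (p t0 ^ 2 + t0 * q t0 ^ 2 / lam)) *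
          Real.exp (2 * A + B / 2)) := by gcongr
      _ = _ := by ring
  calc p t ^ 2 = t ^ (-c) * (t ^ c * p t ^ 2) := by
        rw [← mul_assoc, ← Real.rpow_add htp]; simp
    _ ≤ t ^ (-c) * (3 * Real.exp (2 * A + B / 2) * t0 ^ c *
      (p t0 ^ 2 + t0 * q t0 ^ 2 / lam)) :=
        mul_le_mul_of_nonneg_left hfin2 (Real.rpow_pos_of_pos htp _).le
    _ = _ := by ring

lemma lam_bounds (s : ℝ) (hs : -1 < s) (n : ℕ) (hn : 1 ≤ n) :
    min 1 (1 + s) / 4 * ((n : ℝ) + 1) ^ 2 ≤ n * (n + s) ∧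
      (n : ℝ) * (n + s) ≤ (1 + |s|) * ((n : ℝ) + 1) ^ 2 := by
  have h1 : (1 : ℝ) ≤ n := by exact_mod_cast hn
  set m := min 1 (1 + s) with hm
  have m1 : m ≤ 1 := min_le_left _ _
  have m2 : m ≤ 1 + s := min_le_right _ _
  have m0 : 0 < m := lt_min one_pos (by linarith)
  constructor
  · have h2 : m * n ≤ n + s := by
      rcases le_total 0 s with h | h <;> nlinarith
    have h3 : ((n : ℝ) + 1) ^ 2 ≤ 4 * n ^ 2 := by nlinarith
    calc m / 4 * ((n : ℝ) + 1) ^ 2 ≤ m / 4 * (4 * n ^ 2) := by gcongr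
      _ = n * (m * n) := by ring
      _ ≤ n * (n + s) := by gcongr
  · have h2 : (n : ℝ) + s ≤ (1 + |s|) * (n + 1) := by
      nlinarith [le_abs_self s, abs_nonneg s]
    calc (n : ℝ) * (n + s) ≤ (n + 1) * ((1 + |s|) * (n + 1)) := by
          apply mul_le_mul (by linarith) h2 (by linarith) (by linarith)
      _ = _ := by ring

lemma rpow_between (x y z e : ℝ) (hx : 0 < x) (hxy : x ≤ y) (hyz : y ≤ z) :
    y ^ e ≤ x ^ e + z ^ e := by
  have hy : 0 < y := by linarith
  have hz : 0 < z := by linarith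
  rcases le_total 0 e with h | h
  · have := Real.rpow_le_rpow hy.le hyz h
    have := Real.rpow_pos_of_pos hx e
    linarith
  · have := Real.rpow_le_rpow_of_nonpos hx hxy h
    have := Real.rpow_pos_of_pos hz e
    linarith

set_option maxHeartbeats 1000000 in
lemma half_bound (a b : ℝ) (ha : -1 < a) (hb : -1 < b) :
    ∃ C : ℝ, 0 < C ∧ ∀ n : ℕ, ∀ t : ℝ, 0 < t → t ≤ 1 / 2 →
      |(jPoly a b n).eval t| ≤
        C * ((n : ℝ) + 1) ^ (-(1 : ℝ) / 2) * t ^ (-(max (a / 2 + 1 / 4) 0)) := by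
  obtain ⟨μ, hμ⟩ : ∃ μ, μ = max (a / 2 + 1 / 4) 0 := ⟨_, rfl⟩
  have hμ0 : 0 ≤ μ := hμ ▸ le_max_right _ _
  have hμ1 : a / 2 + 1 / 4 ≤ μ := hμ ▸ le_max_left _ _
  rw [← hμ]
  obtain ⟨kap, hkap⟩ : ∃ k, k = (4 * |a + 1 / 2| + 1) ^ 2 := ⟨_, rfl⟩
  have hk1 : 1 ≤ kap := by rw [hkap]; nlinarith [abs_nonneg (a + 1 / 2)]
  obtain ⟨m, hm⟩ : ∃ m, m = min (a + 1) 1 := ⟨_, rfl⟩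
  have hm0 : 0 < m := by rw [hm]; exact lt_min (by linarith) one_pos
  obtain ⟨K, hK⟩ : ∃ K, K = Real.exp |a| / m * Real.exp kap := ⟨_, rfl⟩
  have hK0 : 0 < K := by rw [hK]; positivity
  obtain ⟨c1, hc1⟩ : ∃ c, c = min 1 (1 + (a + b + 1)) / 4 := ⟨_, rfl⟩
  have hc10 : 0 < c1 := by
    rw [hc1]; exact div_pos (lt_min one_pos (by linarith)) (by norm_num)
  obtain ⟨c2, hc2⟩ : ∃ c, c = 1 + |a + b + 1| := ⟨_, rfl⟩
  have hc20 : 0 < c2 := by rw [hc2]; positivity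
  obtain ⟨A, hA⟩ : ∃ A, A = 4 * |a + 1 / 2| * (1 / 2 + |b + 1 / 2|) := ⟨_, rfl⟩
  obtain ⟨B, hB⟩ : ∃ B, B = 4 * |2 * b + 1| := ⟨_, rfl⟩
  obtain ⟨R, hR⟩ : ∃ R, R = (kap / c2) ^ (a + 1 / 2) + (kap / c1) ^ (a + 1 / 2) := ⟨_, rfl⟩
  have hR0 : 0 < R := by rw [hR]; positivity
  obtain ⟨D, hD⟩ : ∃ D, D = 3 * Real.exp (2 * A + B / 2) * R * (K ^ 2 * (1 + kap)) := ⟨_, rfl⟩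
  have hD0 : 0 < D := by rw [hD]; positivity
  obtain ⟨c', hc'⟩ : ∃ c', c' = kap / c1 + 1 := ⟨_, rfl⟩
  have hc'0 : 0 < c' := by rw [hc']; positivity
  refine ⟨K * c' ^ μ + Real.sqrt D, by positivity, fun n t ht0 ht1 => ?_⟩
  obtain ⟨N, hN⟩ : ∃ N : ℝ, N = (n : ℝ) + 1 := ⟨_, rfl⟩
  have hN1 : 1 ≤ N := by rw [hN]; linarith [(Nat.cast_nonneg n : (0 : ℝ) ≤ n)]
  have hN0 : 0 < N := by linarith
  rw [← hN]
  obtain ⟨lam, hlam⟩ : ∃ l, l = (n : ℝ) * (n + a + b + 1) := ⟨_, rfl⟩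
  have hMb := jB_zero_bound a b ha n
  rw [← hN] at hMb
  have hpos1 : 0 < N ^ (-(1 : ℝ) / 2) := Real.rpow_pos_of_pos hN0 _
  have hpos2 : 0 < t ^ (-μ) := Real.rpow_pos_of_pos ht0 _
  have hNa : 0 < N ^ a := Real.rpow_pos_of_pos hN0 _
  have hcK : ∀ t, 0 ≤ t → lam * t ≤ kap →
      jB a b n 0 / min (a + 1) 1 * Real.exp (lam * t) ≤ K * N ^ a := by
    intro t _ ht
    rw [← hm, hK]
    calc jB a b n 0 / m * Real.exp (lam * t) ≤ (Real.exp |a| * N ^ a) / m * Real.exp kap := by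
          have := hMb.1
          gcongr
          exact hMb.2
      _ = _ := by ring
  rcases le_or_gt (lam * t) kap with hlt | hlt
  · -- series region
    have h1 := (jPoly_series_bound a b ha hb n t ht0.le).1
    rw [← hlam] at h1
    have h2 := h1.trans (hcK t ht0.le hlt)
    have hNt : N ^ 2 ≤ c' / t := by
      rw [le_div_iff₀ ht0]
      rcases Nat.eq_zero_or_pos n with h | h
      · have : N = 1 := by rw [hN, h]; simp
        rw [this, hc']
        have : 0 < kap / c1 := by positivity
        linarith
      · have := (lam_bounds (a + b + 1) (by linarith) n h).1
        rw [← hc1, ← hN] at this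
        have e : (n : ℝ) * (n + (a + b + 1)) = lam := by rw [hlam]; ring
        rw [e] at this
        have h5 : c1 * (N ^ 2 * t) ≤ kap := by
          calc c1 * (N ^ 2 * t) = c1 * N ^ 2 * t := by ring
            _ ≤ lam * t := by gcongr
            _ ≤ kap := hlt
        have h6 : N ^ 2 * t ≤ kap / c1 := by
          rw [le_div_iff₀ hc10]; linarith
        linarith
    have h3 : N ^ a ≤ N ^ (-(1 : ℝ) / 2) * (c' ^ μ * t ^ (-μ)) := by
      calc N ^ a ≤ N ^ (-(1 : ℝ) / 2 + 2 * μ) :=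
            Real.rpow_le_rpow_of_exponent_le hN1 (by linarith)
        _ = N ^ (-(1 : ℝ) / 2) * (N ^ 2) ^ μ := by
            rw [Real.rpow_add hN0, Real.rpow_mul hN0.le]
            norm_num
        _ ≤ N ^ (-(1 : ℝ) / 2) * (c' / t) ^ μ := by gcongr
        _ = _ := by
            rw [Real.div_rpow hc'0.le ht0.le, Real.rpow_neg ht0.le]
            ring
    calc _ ≤ K * N ^ a := h2
      _ ≤ K * (N ^ (-(1 : ℝ) / 2) * (c' ^ μ * t ^ (-μ))) := by gcongr
      _ = (K * c' ^ μ) * N ^ (-(1 : ℝ) / 2) * t ^ (-μ) := by ring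
      _ ≤ _ := by
          gcongr
          exact le_add_of_nonneg_right (Real.sqrt_nonneg D)
  · -- energy region
    have hlam0 : 0 < lam := by
      by_contra hcon
      push Not at hcon
      nlinarith
    have hn1 : 1 ≤ n := by
      by_contra hcon
      have : n = 0 := by omega
      rw [hlam, this] at hlam0
      simp at hlam0
    obtain ⟨l1, l2⟩ := lam_bounds (a + b + 1) (by linarith) n hn1
    have e : (n : ℝ) * (n + (a + b + 1)) = lam := by rw [hlam]; ring
    rw [← hc1, ← hN, e] at l1
    rw [← hc2, ← hN, e] at l2
    have ht0' : kap / lam ≤ t := by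
      rw [div_le_iff₀ hlam0]; linarith
    have hen := energy_bound a b lam hlam0 (fun t => (jPoly a b n).eval t)
      (fun t => (Polynomial.derivative (jPoly a b n)).eval t)
      (fun t => (Polynomial.derivative (Polynomial.derivative (jPoly a b n))).eval t)
      (fun t => Polynomial.hasDerivAt _ t) (fun t => Polynomial.hasDerivAt _ t)
      (fun t => by
        have := congrArg (Polynomial.eval t) (jPoly_ode a b n)
        simp only [Polynomial.eval_add, Polynomial.eval_mul, Polynomial.eval_sub,
          Polynomial.eval_X, Polynomial.eval_one, Polynomial.eval_C, Polynomial.eval_zero] at this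
        rw [hlam]
        exact this) kap hkap A B hA hB t ht0' ht1
    have htt : 0 < kap / lam := by positivity
    have hll : lam * (kap / lam) = kap := by field_simp
    obtain ⟨s1, s2⟩ := jPoly_series_bound a b ha hb n (kap / lam) htt.le
    rw [← hlam] at s1 s2
    have hcK' := hcK (kap / lam) htt.le hll.le
    have s1' := s1.trans hcK'
    have s2' : |(Polynomial.derivative (jPoly a b n)).eval (kap / lam)| ≤ lam * (K * N ^ a) := by
      refine s2.trans ?_
      calc _ = lam * (jB a b n 0 / min (a + 1) 1 * Real.exp (lam * (kap / lam))) := by ring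
        _ ≤ _ := by gcongr
    set p0 := (jPoly a b n).eval (kap / lam)
    set q0 := (Polynomial.derivative (jPoly a b n)).eval (kap / lam)
    have hbr : p0 ^ 2 + kap / lam * q0 ^ 2 / lam ≤ (K ^ 2 * (1 + kap)) * (N ^ a) ^ 2 := by
      have u1 : p0 ^ 2 ≤ (K * N ^ a) ^ 2 := by
        rw [← sq_abs p0]; gcongr
      have u2 : q0 ^ 2 ≤ (lam * (K * N ^ a)) ^ 2 := by
        rw [← sq_abs q0]; gcongr
      calc p0 ^ 2 + kap / lam * q0 ^ 2 / lam
          ≤ (K * N ^ a) ^ 2 + kap / lam * (lam * (K * N ^ a)) ^ 2 / lam := by gcongr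
        _ = _ := by field_simp
    have ht0c : (kap / lam) ^ (a + 1 / 2) ≤ R * (N ^ 2) ^ (-(a + 1 / 2)) := by
      have v : kap / lam = (kap * N ^ 2 / lam) * (N ^ 2)⁻¹ := by field_simp
      rw [v, Real.mul_rpow (by positivity) (by positivity), Real.inv_rpow (by positivity),
        ← Real.rpow_neg (by positivity)]
      have w : (kap * N ^ 2 / lam) ^ (a + 1 / 2) ≤ R := by
        rw [hR]
        apply rpow_between _ _ _ _ (by positivity)
        · rw [div_le_div_iff₀ hc20 hlam0]
          calc kap * lam ≤ kap * (c2 * N ^ 2) := by gcongr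
            _ = _ := by ring
        · rw [div_le_div_iff₀ hlam0 hc10]
          calc kap * N ^ 2 * c1 = kap * (c1 * N ^ 2) := by ring
            _ ≤ _ := by gcongr
      gcongr
    have hpow : (N ^ 2) ^ (-(a + 1 / 2)) * (N ^ a) ^ 2 = (N ^ (-(1 : ℝ) / 2)) ^ 2 := by
      rw [← Real.rpow_natCast N 2, ← Real.rpow_natCast (N ^ a) 2,
        ← Real.rpow_natCast (N ^ (-(1 : ℝ) / 2)) 2, ← Real.rpow_mul hN0.le,
        ← Real.rpow_mul hN0.le, ← Real.rpow_mul hN0.le, ← Real.rpow_add hN0]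
      congr 1
      push_cast
      ring
    have hts : t ^ (-(a + 1 / 2)) ≤ (t ^ (-μ)) ^ 2 := by
      rw [← Real.rpow_natCast (t ^ (-μ)) 2, ← Real.rpow_mul ht0.le]
      apply Real.rpow_le_rpow_of_exponent_ge ht0 (by linarith)
      push_cast
      linarith
    have hsq : (jPoly a b n).eval t ^ 2 ≤
        (Real.sqrt D * N ^ (-(1 : ℝ) / 2) * t ^ (-μ)) ^ 2 := by
      refine hen.trans ?_
      have x1 : 0 ≤ p0 ^ 2 + kap / lam * q0 ^ 2 / lam := by positivity
      calc _ ≤ 3 * (t ^ (-μ)) ^ 2 * Real.exp (2 * A + B / 2) * (R * (N ^ 2) ^ (-(a + 1 / 2))) *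
            ((K ^ 2 * (1 + kap)) * (N ^ a) ^ 2) := by gcongr
        _ = D * (t ^ (-μ)) ^ 2 * ((N ^ 2) ^ (-(a + 1 / 2)) * (N ^ a) ^ 2) := by rw [hD]; ring
        _ = _ := by
            rw [hpow, mul_pow, mul_pow, Real.sq_sqrt hD0.le]
            ring
    have hab := abs_le_of_sq_le_sq hsq (by positivity)
    calc |(jPoly a b n).eval t| ≤ _ := hab
      _ ≤ _ := by
          gcongr
          have : 0 ≤ K * c' ^ μ := by positivity
          linarith

lemma half_bound_x (a b : ℝ) (ha : -1 < a) (hb : -1 < b) :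
    ∃ C : ℝ, 0 < C ∧ ∀ n : ℕ, ∀ x : ℝ, 0 ≤ x → x < 1 →
      |jacobiP a b n x| ≤
        C * ((n : ℝ) + 1) ^ (-(1 : ℝ) / 2) *
          (1 - x) ^ (-(max (a / 2 + 1 / 4) 0)) * (1 + x) ^ (-(max (b / 2 + 1 / 4) 0)) := by
  obtain ⟨C, hC, h⟩ := half_bound a b ha hb
  obtain ⟨μ, hμ⟩ : ∃ μ, μ = max (a / 2 + 1 / 4) 0 := ⟨_, rfl⟩
  obtain ⟨ν, hν⟩ : ∃ ν, ν = max (b / 2 + 1 / 4) 0 := ⟨_, rfl⟩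
  have hν0 : 0 ≤ ν := hν ▸ le_max_right _ _
  rw [← hμ] at h
  rw [← hμ, ← hν]
  refine ⟨C * 2 ^ μ * 2 ^ ν, by positivity, fun n x h0 h1 => ?_⟩
  rw [jacobiP_eq a b n x ⟨by linarith, h1⟩]
  have h2 : 0 < 1 - x := by linarith
  have h3 : 0 < 1 + x := by linarith
  refine (h n ((1 - x) / 2) (by linarith) (by linarith)).trans ?_
  have e1 : ((1 - x) / 2) ^ (-μ) = 2 ^ μ * (1 - x) ^ (-μ) := by
    rw [Real.div_rpow h2.le (by norm_num), Real.rpow_neg (by norm_num : (0 : ℝ) ≤ 2)]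
    field_simp
  have e2 : 1 ≤ 2 ^ ν * (1 + x) ^ (-ν) := by
    rw [Real.rpow_neg h3.le, ← div_eq_mul_inv, one_le_div (by positivity)]
    exact Real.rpow_le_rpow h3.le (by linarith) hν0
  rw [e1]
  have : 0 ≤ C * ((n : ℝ) + 1) ^ (-(1 : ℝ) / 2) * (2 ^ μ * (1 - x) ^ (-μ)) := by positivity
  calc _ ≤ C * ((n : ℝ) + 1) ^ (-(1 : ℝ) / 2) * (2 ^ μ * (1 - x) ^ (-μ)) *
        (2 ^ ν * (1 + x) ^ (-ν)) := le_mul_of_one_le_right this e2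
    _ = _ := by ring

theorem jacobiP_pointwise_bound (α β : ℝ) (hα : -1 < α) (hβ : -1 < β) :
    ∃ C : ℝ, 0 < C ∧ ∀ n : ℕ, ∀ x ∈ Set.Ioo (-1 : ℝ) 1,
      |jacobiP α β n x| ≤
        C * ((n : ℝ) + 1) ^ (-(1 : ℝ) / 2) *
          (1 - x) ^ (-(max (α / 2 + 1 / 4) 0)) * (1 + x) ^ (-(max (β / 2 + 1 / 4) 0)) := by
  obtain ⟨C1, hC1, h1⟩ := half_bound_x α β hα hβ
  obtain ⟨C2, hC2, h2⟩ := half_bound_x β α hβ hα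
  refine ⟨C1 + C2, by positivity, fun n x hx => ?_⟩
  have hp : 0 < 1 + x := by linarith [hx.1]
  have hm : 0 < 1 - x := by linarith [hx.2]
  rcases le_total 0 x with h | h
  · refine (h1 n x h hx.2).trans ?_
    gcongr
    linarith
  · rw [jacobiP_symm]
    refine (h2 n (-x) (by linarith) (by linarith [hx.1])).trans ?_
    rw [sub_neg_eq_add, ← sub_eq_add_neg, mul_assoc, mul_comm ((1 + x) ^ _), ← mul_assoc]
    gcongr
    linarith
end

section
/- Let ν and α satisfy α+ν>-1, let β>-1 and b>0. Then there exist constants C>0 and ω₀>0 such that for every ψ∈W_AC(0,b) and every ω≥ω₀, |∫₀^b x^α (b-x)^β J_ν(ωx) ψ(x) dx| ≤ C ‖ψ‖_{W_AC(0,b)} · ω^{-min{α+1, β+3/2, 3/2}}. -/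
open MeasureTheory Set

/-- ψ is absolutely continuous on [a,b] with integrable derivative (FTC characterization). -/
def IsWAC (a b : ℝ) (psi : ℝ → ℝ) : Prop :=
  MeasureTheory.IntegrableOn (deriv psi) (Set.Ioo a b) ∧
  ∀ x ∈ Set.Icc a b, psi x = psi a + ∫ t in a..x, deriv psi t

/-- The W_AC norm: ‖ψ‖_∞ + ‖ψ'‖_{L¹}. -/
noncomputable def wacNorm (a b : ℝ) (psi : ℝ → ℝ) : ℝ :=
  (⨆ x : Set.Icc a b, |psi (x : ℝ)|) + ∫ t in a..b, |deriv psi t|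

/-- Bessel function of the first kind of order ν. -/
noncomputable def besselJ (nu : ℝ) (x : ℝ) : ℝ :=
  ∑' m : ℕ, ((-1 : ℝ) ^ m / ((m.factorial : ℝ) * Real.Gamma ((m : ℝ) + nu + 1))) *
    (x / 2) ^ (2 * (m : ℝ) + nu)


/-- `f` is integrable on `[a,c]` and its primitives from `a` are bounded by `B`. -/
def PB (f : ℝ → ℝ) (a c B : ℝ) : Prop :=
  IntervalIntegrable f volume a c ∧ ∀ t ∈ Icc a c, |∫ x in a..t, f x| ≤ B

lemma PB.mono_bound {f : ℝ → ℝ} {a c B B' : ℝ} (h : PB f a c B) (hB : B ≤ B') : PB f a c B' :=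
  ⟨h.1, fun t ht => (h.2 t ht).trans hB⟩

lemma PB.congr {f g : ℝ → ℝ} {a c B : ℝ} (hac : a ≤ c) (h : PB f a c B)
    (hfg : ∀ x ∈ Ioo a c, f x = g x) : PB g a c B := by
  refine ⟨h.1.congr_uIoo ?_, fun t ht => ?_⟩
  · intro x hx
    rw [uIoo_of_le hac] at hx
    exact hfg x hx
  · rw [← intervalIntegral.integral_congr_Ioo_of_le (f := f) (g := g) ht.1]
    · exact h.2 t ht
    · intro x hx
      exact hfg x ⟨hx.1, hx.2.trans_le ht.2⟩

lemma PB.trans {f : ℝ → ℝ} {a p c B₁ B₂ : ℝ} (hap : a ≤ p) (hpc : p ≤ c)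
    (h₁ : PB f a p B₁) (h₂ : PB f p c B₂) : PB f a c (B₁ + B₂) := by
  refine ⟨h₁.1.trans h₂.1, fun t ht => ?_⟩
  have hB2 : 0 ≤ B₂ := (abs_nonneg _).trans (h₂.2 p ⟨le_rfl, hpc⟩)
  rcases le_total t p with h | h
  · linarith [h₁.2 t ⟨ht.1, h⟩]
  · have hi : IntervalIntegrable f volume p t := h₂.1.mono_set (by
      rw [uIcc_of_le h, uIcc_of_le hpc]; exact Icc_subset_Icc le_rfl ht.2)
    rw [← intervalIntegral.integral_add_adjacent_intervals h₁.1 hi]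
    exact (abs_add_le _ _).trans (add_le_add (h₁.2 p ⟨hap, le_rfl⟩) (h₂.2 t ⟨h, ht.2⟩))

lemma PB.of_le {f h : ℝ → ℝ} {a c B : ℝ} (hac : a ≤ c) (hf : ContinuousOn f (Ioo a c))
    (hh : IntervalIntegrable h volume a c) (hfh : ∀ x ∈ Ioo a c, |f x| ≤ h x)
    (hB : ∫ x in a..c, h x ≤ B) : PB f a c B := by
  have key : ∀ᵐ x ∂(volume.restrict (Ioc a c)), x ∈ Ioo a c := by
    rw [← Measure.restrict_congr_set Ioo_ae_eq_Ioc]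
    exact ae_restrict_mem measurableSet_Ioo
  have hfint : IntervalIntegrable f volume a c := by
    apply hh.mono_fun'
    · rw [uIoc_of_le hac, ← Measure.restrict_congr_set Ioo_ae_eq_Ioc]
      exact hf.aestronglyMeasurable measurableSet_Ioo
    · rw [uIoc_of_le hac]
      filter_upwards [key] with x hx using hfh x hx
  refine ⟨hfint, fun t ht => ?_⟩
  have s1 : |∫ x in a..t, f x| ≤ ∫ x in a..t, |f x| :=
    intervalIntegral.abs_integral_le_integral_abs ht.1
  have s2 : ∫ x in a..t, |f x| ≤ ∫ x in a..c, |f x| := by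
    apply intervalIntegral.integral_mono_interval le_rfl ht.1 ht.2
    · exact Filter.Eventually.of_forall fun x => abs_nonneg _
    · exact hfint.abs
  have s3 : ∫ x in a..c, |f x| ≤ ∫ x in a..c, h x := by
    apply intervalIntegral.integral_mono_ae_restrict hac hfint.abs hh
    rw [← Measure.restrict_congr_set Ioo_ae_eq_Icc]
    filter_upwards [ae_restrict_mem measurableSet_Ioo] with x hx using hfh x hx
  linarith

/-- van der Corput type integration by parts. -/
lemma PB.vdc {f ψ φ : ℝ → ℝ} {a c B : ℝ} (hac : a ≤ c) (h : PB f a c B)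
    (hφ : IntervalIntegrable φ volume a c)
    (hψ : ∀ x ∈ Icc a c, ψ x = ψ a + ∫ t in a..x, φ t) :
    |∫ x in a..c, f x * ψ x| ≤ B * (|ψ c| + ∫ t in a..c, |φ t|) := by
  set F : ℝ → ℝ := fun x => ∫ t in a..x, f t with hF
  set Ψ : ℝ → ℝ := fun x => ψ a + ∫ t in a..x, φ t with hΨ
  have hFac : AbsolutelyContinuousOnInterval F a c :=
    h.1.absolutelyContinuousOnInterval_intervalIntegral left_mem_uIcc
  have hΨ0 : AbsolutelyContinuousOnInterval (fun x => ∫ t in a..x, φ t) a c :=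
    hφ.absolutelyContinuousOnInterval_intervalIntegral left_mem_uIcc
  have hconst : AbsolutelyContinuousOnInterval (fun _ : ℝ => ψ a) a c := by
    have := LipschitzWith.const (α := ℝ) (ψ a)
    exact (this.lipschitzOnWith (s := uIcc a c)).absolutelyContinuousOnInterval
  have hΨac : AbsolutelyContinuousOnInterval Ψ a c := hconst.add hΨ0
  have ibp := hΨac.integral_mul_deriv_eq_deriv_mul hFac
  have e1 : ∫ x in a..c, f x * ψ x = ∫ x in a..c, Ψ x * deriv F x := by
    apply intervalIntegral.integral_congr_ae
    filter_upwards [h.1.ae_hasDerivAt_integral] with x hx hx2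
    have hx3 : x ∈ uIcc a c := uIoc_subset_uIcc hx2
    rw [(hx hx3 a left_mem_uIcc).deriv, hψ x (by rwa [uIcc_of_le hac] at hx3)]
    ring
  have e2 : ∫ x in a..c, deriv Ψ x * F x = ∫ x in a..c, φ x * F x := by
    apply intervalIntegral.integral_congr_ae
    filter_upwards [hφ.ae_hasDerivAt_integral] with x hx hx2
    have hx3 : x ∈ uIcc a c := uIoc_subset_uIcc hx2
    rw [((hx hx3 a left_mem_uIcc).const_add (ψ a)).deriv]
  have hFa : F a = 0 := by simp [hF]
  have hcc : Ψ c = ψ c := (hψ c ⟨hac, le_rfl⟩).symm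
  rw [e1, ibp, e2, hFa, hcc, mul_zero, sub_zero]
  have b1 : |∫ x in a..c, φ x * F x| ≤ ∫ x in a..c, B * |φ x| := by
    rw [← Real.norm_eq_abs]
    apply intervalIntegral.norm_integral_le_of_norm_le hac
    · refine Filter.Eventually.of_forall fun x hx => ?_
      rw [Real.norm_eq_abs, abs_mul, mul_comm]
      exact mul_le_mul_of_nonneg_right (h.2 x ⟨hx.1.le, hx.2⟩) (abs_nonneg _)
    · exact hφ.abs.const_mul B
  rw [intervalIntegral.integral_const_mul] at b1
  have b2 : |ψ c * F c| ≤ B * |ψ c| := by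
    rw [abs_mul, mul_comm]
    exact mul_le_mul_of_nonneg_right (h.2 c ⟨hac, le_rfl⟩) (abs_nonneg _)
  calc _ ≤ |ψ c * F c| + |∫ x in a..c, φ x * F x| := abs_sub _ _
    _ ≤ _ := by rw [mul_add]; exact add_le_add b2 b1

/-- multiplying by a monotone `C¹` weight -/
lemma PB.mul_weight {f w w' : ℝ → ℝ} {a c B M : ℝ} (hac : a ≤ c) (h : PB f a c B)
    (hw : ∀ x ∈ Icc a c, HasDerivAt w (w' x) x) (hw' : ContinuousOn w' (Icc a c))
    (hsign : (∀ x ∈ Icc a c, 0 ≤ w' x) ∨ (∀ x ∈ Icc a c, w' x ≤ 0))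
    (hM : ∀ x ∈ Icc a c, |w x| ≤ M) : PB (fun x => f x * w x) a c (3 * M * B) := by
  have hB : 0 ≤ B := (abs_nonneg _).trans (h.2 a ⟨le_rfl, hac⟩)
  have hwc : ContinuousOn w (uIcc a c) := by
    rw [uIcc_of_le hac]; exact fun x hx => (hw x hx).continuousAt.continuousWithinAt
  refine ⟨h.1.mul_continuousOn hwc, fun t ht => ?_⟩
  have hsub : Icc a t ⊆ Icc a c := Icc_subset_Icc le_rfl ht.2
  have hi : ∀ x ∈ Icc a t, IntervalIntegrable w' volume a x := fun x hx =>
    (hw'.mono (by rw [uIcc_of_le hx.1]; exact Icc_subset_Icc le_rfl (hx.2.trans ht.2))).intervalIntegrable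
  have hftc : ∀ x ∈ Icc a t, ∫ y in a..x, w' y = w x - w a := fun x hx =>
    intervalIntegral.integral_eq_sub_of_hasDerivAt (fun y hy => hw y (by
      rw [uIcc_of_le hx.1] at hy; exact ⟨hy.1, hy.2.trans (hx.2.trans ht.2)⟩)) (hi x hx)
  have hPB : PB f a t B := ⟨h.1.mono_set (by
      rw [uIcc_of_le ht.1, uIcc_of_le hac]; exact hsub), fun s hs => h.2 s (hsub hs)⟩
  have := hPB.vdc (ψ := w) (φ := w') ht.1 (hi t ⟨ht.1, le_rfl⟩)
    (fun x hx => by rw [hftc x hx]; ring)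
  refine this.trans ?_
  have hta := hM t ht
  have haa := hM a ⟨le_rfl, hac⟩
  have hv : ∫ y in a..t, |w' y| ≤ 2 * M := by
    rcases hsign with hs | hs
    · have : ∫ y in a..t, |w' y| = ∫ y in a..t, w' y :=
        intervalIntegral.integral_congr fun y hy => by
          rw [uIcc_of_le ht.1] at hy; exact abs_of_nonneg (hs y (hsub hy))
      rw [this, hftc t ⟨ht.1, le_rfl⟩]
      linarith [le_abs_self (w t), neg_abs_le (w a)]
    · have : ∫ y in a..t, |w' y| = ∫ y in a..t, -w' y :=
        intervalIntegral.integral_congr fun y hy => by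
          rw [uIcc_of_le ht.1] at hy; exact abs_of_nonpos (hs y (hsub hy))
      rw [this, intervalIntegral.integral_neg, hftc t ⟨ht.1, le_rfl⟩]
      linarith [le_abs_self (w a), neg_abs_le (w t)]
  nlinarith

noncomputable def bc (ν : ℝ) (m : ℕ) : ℝ :=
  (-1 : ℝ) ^ m / ((m.factorial : ℝ) * Real.Gamma ((m : ℝ) + ν + 1))

noncomputable def bPhi (ν z : ℝ) : ℝ := ∑' m : ℕ, bc ν m * z ^ m

lemma bc_shift (ν : ℝ) (m : ℕ) : ((m : ℝ) + 1) * bc ν (m + 1) = - bc (ν + 1) m := by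
  unfold bc
  have : ((m + 1 : ℕ) : ℝ) + ν + 1 = (m : ℝ) + (ν + 1) + 1 := by push_cast; ring
  rw [this, Nat.factorial_succ]
  have h1 : (m : ℝ) + 1 ≠ 0 := by positivity
  have h2 : (m.factorial : ℝ) ≠ 0 := by positivity
  push_cast
  by_cases hG : Real.Gamma ((m : ℝ) + (ν + 1) + 1) = 0
  · simp [hG]
  · field_simp
    ring

lemma bc_gamma (ν : ℝ) (m : ℕ) : ((m : ℝ) + ν + 1) * bc (ν + 1) m = bc ν m := by
  unfold bc
  have h2 : (m.factorial : ℝ) ≠ 0 := by positivity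
  by_cases h : (m : ℝ) + ν + 1 = 0
  · rw [h]; simp
  · have : (m : ℝ) + (ν + 1) + 1 = ((m : ℝ) + ν + 1) + 1 := by ring
    rw [this, Real.Gamma_add_one h]
    by_cases hG : Real.Gamma ((m : ℝ) + ν + 1) = 0
    · simp [hG]
    · field_simp

lemma bc_rec (ν : ℝ) (m : ℕ) : ((m : ℝ) + 1) * ((m : ℝ) + ν + 1) * bc ν (m + 1) = - bc ν m := by
  have := bc_shift ν m
  have h2 := bc_gamma ν m
  rw [← h2]
  linear_combination ((m : ℝ) + ν + 1) * this

lemma bc_summable (ν z : ℝ) : Summable fun m : ℕ => bc ν m * z ^ m := by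
  apply summable_of_ratio_norm_eventually_le (r := 1 / 2) (by norm_num)
  have h1 : ∀ᶠ m : ℕ in Filter.atTop, 2 * |z| + |ν| ≤ (m : ℝ) :=
    tendsto_natCast_atTop_atTop.eventually_ge_atTop _
  filter_upwards [h1] with m hm
  have hν := neg_abs_le ν
  have hz := abs_nonneg z
  have hν0 := abs_nonneg ν
  have hr := congrArg abs (bc_rec ν m)
  rw [abs_neg, abs_mul, abs_of_nonneg (by apply mul_nonneg <;> nlinarith :
    0 ≤ ((m : ℝ) + 1) * ((m : ℝ) + ν + 1))] at hr
  rw [norm_mul, norm_mul, norm_pow, norm_pow, Real.norm_eq_abs, Real.norm_eq_abs,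
    Real.norm_eq_abs, ← hr, pow_succ]
  have key : |z| ≤ 1 / 2 * (((m : ℝ) + 1) * ((m : ℝ) + ν + 1)) := by nlinarith
  have hp : 0 ≤ |bc ν (m + 1)| * |z| ^ m := by positivity
  calc |bc ν (m + 1)| * (|z| ^ m * |z|) = (|bc ν (m + 1)| * |z| ^ m) * |z| := by ring
    _ ≤ (|bc ν (m + 1)| * |z| ^ m) * (1 / 2 * (((m : ℝ) + 1) * ((m : ℝ) + ν + 1))) :=
        mul_le_mul_of_nonneg_left key hp
    _ = _ := by ring

lemma bPhi_hasDerivAt (ν z : ℝ) : HasDerivAt (bPhi ν) (-bPhi (ν + 1) z) z := by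
  have hval : ∀ y : ℝ, ∑' m : ℕ, bc ν m * ((m : ℝ) * y ^ (m - 1)) = - bPhi (ν + 1) y := by
    intro y
    have e : ∀ m : ℕ, bc ν (m + 1) * (((m + 1 : ℕ) : ℝ) * y ^ (m + 1 - 1)) =
        -(bc (ν + 1) m * y ^ m) := by
      intro m
      have := bc_shift ν m
      push_cast
      linear_combination y ^ m * this
    have hs : Summable fun m : ℕ => bc ν m * ((m : ℝ) * y ^ (m - 1)) := by
      rw [← summable_nat_add_iff 1]
      simp_rw [e]
      exact (bc_summable (ν + 1) y).neg
    rw [hs.tsum_eq_zero_add]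
    simp_rw [e, tsum_neg]
    simp [bPhi]
  rw [← hval]
  set R : ℝ := |z| + 1 with hR
  have hR0 : 0 < R := by positivity
  change HasDerivAt (fun z => ∑' m : ℕ, bc ν m * z ^ m) _ z
  refine hasDerivAt_tsum_of_isPreconnected (g := fun (m : ℕ) (z : ℝ) => bc ν m * z ^ m)
    (g' := fun (m : ℕ) (y : ℝ) => bc ν m * ((m : ℝ) * y ^ (m - 1))) (u := fun m : ℕ => |bc ν m * ((m : ℝ) * R ^ (m - 1))|)
    (t := Ioo (-R) R) (y₀ := 0) ?_ isOpen_Ioo isPreconnected_Ioo ?_ ?_ ?_ ?_ ?_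
  · rw [← summable_nat_add_iff 1]
    have e : ∀ m : ℕ, |bc ν (m + 1) * (((m + 1 : ℕ) : ℝ) * R ^ (m + 1 - 1))| =
        |bc (ν + 1) m * R ^ m| := by
      intro m
      have := bc_shift ν m
      push_cast
      rw [← abs_neg (bc (ν + 1) m * R ^ m)]
      congr 1
      linear_combination R ^ m * this
    simp_rw [e]
    exact (bc_summable (ν + 1) R).abs
  · intro m y _
    exact (hasDerivAt_pow m y).const_mul _
  · intro m y hy
    rw [Real.norm_eq_abs, abs_mul, abs_mul, abs_mul (bc ν m), abs_mul (m : ℝ), abs_pow, abs_pow]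
    have : |y| ≤ |R| := by
      rw [abs_of_pos hR0]; exact abs_le.2 ⟨hy.1.le, hy.2.le⟩
    gcongr
  · exact ⟨by linarith, hR0⟩
  · exact bc_summable ν 0
  · exact abs_lt.1 (by linarith)

lemma bPhi_rec (ν z : ℝ) : z * bPhi (ν + 1 + 1) z = (ν + 1) * bPhi (ν + 1) z - bPhi ν z := by
  unfold bPhi
  have hs0 := bc_summable ν z
  have hs1 := bc_summable (ν + 1) z
  have hs2 := bc_summable (ν + 1 + 1) z
  rw [← tsum_mul_left, ← tsum_mul_left, ← (hs1.mul_left (ν + 1)).tsum_sub hs0,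
    ((hs1.mul_left (ν + 1)).sub hs0).tsum_eq_zero_add]
  have h0 := bc_gamma ν 0
  have : (ν + 1) * (bc (ν + 1) 0 * z ^ 0) - bc ν 0 * z ^ 0 = 0 := by
    rw [← h0]; push_cast; ring
  rw [this, zero_add]
  congr 1
  ext m
  have h1 := bc_gamma ν (m + 1)
  have h2 := bc_shift (ν + 1) m
  rw [← h1]
  push_cast
  linear_combination (z ^ (m + 1)) * h2

lemma besselJ_eq (ν x : ℝ) (hx : 0 < x) : besselJ ν x = (x / 2) ^ ν * bPhi ν (x ^ 2 / 4) := by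
  unfold besselJ bPhi
  rw [← tsum_mul_left]
  congr 1
  ext m
  have h : 0 < x / 2 := by positivity
  rw [Real.rpow_add h, show (2 * (m : ℝ)) = ((2 * m : ℕ) : ℝ) by push_cast; ring,
    Real.rpow_natCast, pow_mul, show (x / 2) ^ 2 = x ^ 2 / 4 by ring]
  unfold bc
  ring

/-- `√x J_ν(x)` up to a constant. -/
noncomputable def bu (ν x : ℝ) : ℝ := x ^ (ν + 1 / 2) * bPhi ν (x ^ 2 / 4)

noncomputable def bu' (ν x : ℝ) : ℝ :=
  (ν + 1 / 2) * x ^ (ν - 1 / 2) * bPhi ν (x ^ 2 / 4)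
    - x ^ (ν + 3 / 2) / 2 * bPhi (ν + 1) (x ^ 2 / 4)

lemma besselJ_eq_bu (ν x : ℝ) (hx : 0 < x) :
    besselJ ν x = (1 / 2) ^ ν * x ^ (-(1 / 2) : ℝ) * bu ν x := by
  rw [besselJ_eq ν x hx, bu, show x / 2 = (1 / 2) * x by ring,
    Real.mul_rpow (by norm_num) hx.le, ← mul_assoc, mul_assoc _ (x ^ (-(1 / 2) : ℝ)),
    ← Real.rpow_add hx]
  congr 3
  ring

lemma hasDerivAt_bPhi_sq (ν x : ℝ) :
    HasDerivAt (fun x : ℝ => bPhi ν (x ^ 2 / 4)) (-(x / 2) * bPhi (ν + 1) (x ^ 2 / 4)) x := by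
  have h1 : HasDerivAt (fun x : ℝ => x ^ 2 / 4) (x / 2) x := by
    have := (hasDerivAt_pow 2 x).div_const 4
    refine this.congr_deriv ?_
    push_cast
    ring
  have := (bPhi_hasDerivAt ν (x ^ 2 / 4)).comp x h1
  refine this.congr_deriv ?_
  ring

lemma bu_hasDerivAt (ν x : ℝ) (hx : 0 < x) : HasDerivAt (bu ν) (bu' ν x) x := by
  have h1 := Real.hasDerivAt_rpow_const (x := x) (p := ν + 1 / 2) (Or.inl hx.ne')
  have := h1.mul (hasDerivAt_bPhi_sq ν x)
  refine this.congr_deriv ?_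
  unfold bu'
  rw [show ν + 1 / 2 - 1 = ν - 1 / 2 by ring,
    show ν + 3 / 2 = (ν + 1 / 2) + 1 by ring, Real.rpow_add_one hx.ne']
  ring

lemma bu'_hasDerivAt (ν x : ℝ) (hx : 0 < x) :
    HasDerivAt (bu' ν) (-bu ν x + (ν ^ 2 - 1 / 4) * (bu ν x / x ^ 2)) x := by
  have h1 := (Real.hasDerivAt_rpow_const (x := x) (p := ν - 1 / 2) (Or.inl hx.ne')).const_mul
    (ν + 1 / 2)
  have h2 := (Real.hasDerivAt_rpow_const (x := x) (p := ν + 3 / 2) (Or.inl hx.ne')).div_const 2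
  have := (h1.mul (hasDerivAt_bPhi_sq ν x)).sub (h2.mul (hasDerivAt_bPhi_sq (ν + 1) x))
  refine this.congr_deriv ?_
  unfold bu
  have hr := bPhi_rec ν (x ^ 2 / 4)
  set P0 := bPhi ν (x ^ 2 / 4)
  set P1 := bPhi (ν + 1) (x ^ 2 / 4)
  set P2 := bPhi (ν + 1 + 1) (x ^ 2 / 4)
  have hP : P0 = (ν + 1) * P1 - x ^ 2 / 4 * P2 := by linarith
  have e4 : x ^ (ν - 1 / 2) = x ^ (ν - 1 / 2 - 1) * x := by
    rw [← Real.rpow_add_one hx.ne']; congr 1; ring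
  have e2 : x ^ (ν + 1 / 2) = x ^ (ν - 1 / 2 - 1) * x * x := by
    rw [← Real.rpow_add_one hx.ne', ← Real.rpow_add_one hx.ne']; congr 1; ring
  have e1 : x ^ (ν + 3 / 2 - 1) = x ^ (ν - 1 / 2 - 1) * x * x := by
    rw [← e2]; congr 1; ring
  have e3 : x ^ (ν + 3 / 2) = x ^ (ν - 1 / 2 - 1) * x * x * x := by
    rw [← e2, ← Real.rpow_add_one hx.ne']; congr 1; ring
  rw [e1, e2, e3, e4]
  set q := x ^ (ν - 1 / 2 - 1)
  field_simp
  rw [hP]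
  ring

lemma bu_bounded (ν : ℝ) : ∃ M : ℝ, 0 < M ∧ ∀ x : ℝ, 1 ≤ x → |bu ν x| ≤ M ∧ |bu' ν x| ≤ M := by
  set k : ℝ := ν ^ 2 - 1 / 4 with hk
  set G : ℝ → ℝ := fun x => (bu ν x ^ 2 + bu' ν x ^ 2) * Real.exp (|k| * x⁻¹) with hG
  have hd : ∀ x : ℝ, 0 < x → HasDerivAt G
      ((2 * bu ν x * bu' ν x + 2 * bu' ν x * (-bu ν x + k * (bu ν x / x ^ 2))) *
        Real.exp (|k| * x⁻¹) + (bu ν x ^ 2 + bu' ν x ^ 2) *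
        (Real.exp (|k| * x⁻¹) * (|k| * (-(x ^ 2)⁻¹)))) x := by
    intro x hx
    have h1 := ((bu_hasDerivAt ν x hx).pow 2).add ((bu'_hasDerivAt ν x hx).pow 2)
    have h2 := ((hasDerivAt_inv hx.ne').const_mul |k|).exp
    have := h1.mul h2
    refine this.congr_deriv ?_
    simp [hk]
  have hanti : AntitoneOn G (Ici 1) := by
    apply antitoneOn_of_deriv_nonpos (convex_Ici 1)
    · intro x hx
      exact (hd x (lt_of_lt_of_le one_pos hx)).continuousAt.continuousWithinAt
    · intro x hx
      rw [interior_Ici] at hx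
      exact (hd x (one_pos.trans hx)).differentiableAt.differentiableWithinAt
    · intro x hx
      rw [interior_Ici] at hx
      have hx0 : 0 < x := one_pos.trans hx
      rw [(hd x hx0).deriv]
      have hE := Real.exp_pos (|k| * x⁻¹)
      have : (2 * bu ν x * bu' ν x + 2 * bu' ν x * (-bu ν x + k * (bu ν x / x ^ 2))) *
        Real.exp (|k| * x⁻¹) + (bu ν x ^ 2 + bu' ν x ^ 2) *
        (Real.exp (|k| * x⁻¹) * (|k| * (-(x ^ 2)⁻¹))) =
        -(Real.exp (|k| * x⁻¹) * (x ^ 2)⁻¹ *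
          (|k| * (bu ν x ^ 2 + bu' ν x ^ 2) - k * (2 * bu ν x * bu' ν x))) := by
        field_simp
        ring
      rw [this]
      have h3 : k * (2 * bu ν x * bu' ν x) ≤ |k| * (bu ν x ^ 2 + bu' ν x ^ 2) := by
        refine (le_abs_self _).trans ?_
        rw [abs_mul]
        apply mul_le_mul_of_nonneg_left _ (abs_nonneg k)
        rw [abs_le]
        constructor <;> nlinarith [sq_nonneg (bu ν x + bu' ν x), sq_nonneg (bu ν x - bu' ν x)]
      have : 0 ≤ Real.exp (|k| * x⁻¹) * (x ^ 2)⁻¹ := by positivity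
      have := mul_nonneg this (sub_nonneg.2 h3)
      linarith
  have hG1 : 0 ≤ G 1 := by simp only [hG]; positivity
  refine ⟨G 1 + 1, by linarith, fun x hx => ?_⟩
  have hx0 : 0 < x := one_pos.trans_le hx
  have hle : G x ≤ G 1 := hanti self_mem_Ici hx hx
  have hE : 1 ≤ Real.exp (|k| * x⁻¹) := Real.one_le_exp (by positivity)
  have h4 : bu ν x ^ 2 + bu' ν x ^ 2 ≤ G x := by
    simp only [hG]
    exact le_mul_of_one_le_right (by positivity) hE
  constructor
  · nlinarith [sq_nonneg (|bu ν x| - 1), sq_abs (bu ν x), sq_nonneg (bu' ν x), abs_nonneg (bu ν x)]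
  · nlinarith [sq_nonneg (|bu' ν x| - 1), sq_abs (bu' ν x), sq_nonneg (bu ν x), abs_nonneg (bu' ν x)]

lemma bu_continuousOn (ν : ℝ) : ContinuousOn (bu ν) (Ioi 0) := fun x hx =>
  (bu_hasDerivAt ν x hx).continuousAt.continuousWithinAt

lemma bu_integral_bounded (ν : ℝ) : ∃ C : ℝ, 0 < C ∧ ∀ S T : ℝ, 1 ≤ S → S ≤ T →
    |∫ x in S..T, bu ν x| ≤ C := by
  obtain ⟨M, hM, hb⟩ := bu_bounded ν
  set k : ℝ := ν ^ 2 - 1 / 4 with hk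
  refine ⟨2 * M + |k| * M, by positivity, fun S T hS hST => ?_⟩
  have hpos : ∀ x ∈ uIcc S T, 0 < x := by
    intro x hx
    rw [uIcc_of_le hST] at hx
    linarith [hx.1]
  have hc : ContinuousOn (bu ν) (uIcc S T) := (bu_continuousOn ν).mono hpos
  have hc2 : ContinuousOn (fun x => k * (bu ν x / x ^ 2)) (uIcc S T) :=
    continuousOn_const.mul (hc.div (by fun_prop) (fun x hx => by have := hpos x hx; positivity))
  have hftc := intervalIntegral.integral_eq_sub_of_hasDerivAt
    (fun x hx => bu'_hasDerivAt ν x (hpos x hx)) (hc.neg.add hc2).intervalIntegrable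
  have hsplit : ∫ x in S..T, (-bu ν x + k * (bu ν x / x ^ 2)) =
      -(∫ x in S..T, bu ν x) + ∫ x in S..T, k * (bu ν x / x ^ 2) := by
    rw [← intervalIntegral.integral_neg]
    exact intervalIntegral.integral_add hc.neg.intervalIntegrable hc2.intervalIntegrable
  rw [hsplit] at hftc
  have hinv : ∫ x in S..T, (|k| * M) * (x ^ 2)⁻¹ = (|k| * M) * (S⁻¹ - T⁻¹) := by
    rw [intervalIntegral.integral_const_mul]
    congr 1
    have hd : ∀ x ∈ uIcc S T, HasDerivAt (fun x : ℝ => -x⁻¹) ((x ^ 2)⁻¹) x := fun x hx => by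
      exact (hasDerivAt_inv (hpos x hx).ne').neg.congr_deriv (by simp)
    rw [intervalIntegral.integral_eq_sub_of_hasDerivAt hd]
    · ring
    · apply ContinuousOn.intervalIntegrable
      exact ContinuousOn.inv₀ (by fun_prop) (fun x hx => by have := hpos x hx; positivity)
  have hk2 : |∫ x in S..T, k * (bu ν x / x ^ 2)| ≤ ∫ x in S..T, (|k| * M) * (x ^ 2)⁻¹ := by
    rw [← Real.norm_eq_abs]
    apply intervalIntegral.norm_integral_le_of_norm_le hST
    · refine Filter.Eventually.of_forall fun x hx => ?_
      have hx1 : 1 ≤ x := hS.trans hx.1.le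
      rw [Real.norm_eq_abs, abs_mul, abs_div, abs_of_nonneg (sq_nonneg x), div_eq_mul_inv,
        ← mul_assoc]
      gcongr
      exact (hb x hx1).1
    · apply ContinuousOn.intervalIntegrable
      exact continuousOn_const.mul
        (ContinuousOn.inv₀ (by fun_prop) (fun x hx => by have := hpos x hx; positivity))
  rw [hinv] at hk2
  have hS1 : S⁻¹ ≤ 1 := inv_le_one_of_one_le₀ hS
  have hT0 : 0 ≤ T⁻¹ := inv_nonneg.2 (by linarith)
  have hk3 : (|k| * M) * (S⁻¹ - T⁻¹) ≤ |k| * M := by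
    apply mul_le_of_le_one_right (by positivity); linarith
  have a1 := abs_le.1 (hb S hS).2
  have a2 := abs_le.1 (hb T (hS.trans hST)).2
  have a3 := abs_le.1 hk2
  rw [abs_le]
  constructor <;> linarith

lemma bu_small (ν : ℝ) : ∃ K : ℝ, 0 < K ∧ ∀ x : ℝ, 0 < x → x ≤ 1 →
    |bu ν x| ≤ K * x ^ (ν + 1 / 2) := by
  have hc : ContinuousOn (fun x : ℝ => bPhi ν (x ^ 2 / 4)) (Icc 0 1) := fun x _ =>
    (hasDerivAt_bPhi_sq ν x).continuousAt.continuousWithinAt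
  obtain ⟨K, hK⟩ := isCompact_Icc.exists_bound_of_continuousOn hc
  refine ⟨|K| + 1, by positivity, fun x h0 h1 => ?_⟩
  have := hK x ⟨h0.le, h1⟩
  rw [Real.norm_eq_abs] at this
  rw [bu, abs_mul, abs_of_nonneg (by positivity), mul_comm]
  gcongr
  linarith [le_abs_self K]

lemma PB.const_mul {f : ℝ → ℝ} {a c B : ℝ} (h : PB f a c B) (k : ℝ) :
    PB (fun x => k * f x) a c (|k| * B) := by
  refine ⟨h.1.const_mul k, fun t ht => ?_⟩
  rw [intervalIntegral.integral_const_mul, abs_mul]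
  exact mul_le_mul_of_nonneg_left (h.2 t ht) (abs_nonneg k)

lemma rpow_le_ends {s t x p : ℝ} (hs : 0 < s) (hsx : s ≤ x) (hxt : x ≤ t) :
    |x ^ p| ≤ s ^ p + t ^ p := by
  have hx : 0 < x := hs.trans_le hsx
  have ht : 0 < t := hx.trans_le hxt
  have hsp := Real.rpow_pos_of_pos hs p
  have htp := Real.rpow_pos_of_pos ht p
  rw [abs_of_pos (Real.rpow_pos_of_pos hx p)]
  rcases le_total 0 p with hp | hp
  · linarith [Real.rpow_le_rpow hx.le hxt hp]
  · linarith [Real.rpow_le_rpow_of_nonpos hs hsx hp]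

lemma PB.mul_rpow {f : ℝ → ℝ} {a c B : ℝ} (ha : 0 < a) (hac : a ≤ c) (h : PB f a c B) (p : ℝ) :
    PB (fun x => f x * x ^ p) a c (3 * (a ^ p + c ^ p) * B) := by
  have hpos : ∀ x ∈ Icc a c, 0 < x := fun x hx => ha.trans_le hx.1
  refine h.mul_weight (w := fun x => x ^ p) (w' := fun x => p * x ^ (p - 1)) hac
    (fun x hx => Real.hasDerivAt_rpow_const (Or.inl (hpos x hx).ne')) ?_ ?_
    (fun x hx => rpow_le_ends ha hx.1 hx.2)
  · exact continuousOn_const.mul (continuousOn_id.rpow_const fun x hx => Or.inl (hpos x hx).ne')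
  · rcases le_total 0 p with hp | hp
    · exact Or.inl fun x hx => mul_nonneg hp (Real.rpow_nonneg (hpos x hx).le _)
    · exact Or.inr fun x hx =>
        mul_nonpos_of_nonpos_of_nonneg hp (Real.rpow_nonneg (hpos x hx).le _)

lemma PB.mul_rpow_sub {f : ℝ → ℝ} {a c b B : ℝ} (hc : c < b) (hac : a ≤ c) (h : PB f a c B)
    (p : ℝ) : PB (fun x => f x * (b - x) ^ p) a c (3 * ((b - c) ^ p + (b - a) ^ p) * B) := by
  have hpos : ∀ x ∈ Icc a c, 0 < b - x := fun x hx => by linarith [hx.2]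
  refine h.mul_weight (w := fun x => (b - x) ^ p) (w' := fun x => -(p * (b - x) ^ (p - 1))) hac
    (fun x hx => ?_) ?_ ?_
    (fun x hx => rpow_le_ends (by linarith) (by linarith [hx.2]) (by linarith [hx.1]))
  · have h1 : HasDerivAt (fun x : ℝ => b - x) (-1) x := (hasDerivAt_id x).const_sub b
    exact (h1.rpow_const (p := p) (Or.inl (hpos x hx).ne')).congr_deriv (by ring)
  · exact (continuousOn_const.mul ((continuousOn_const.sub continuousOn_id).rpow_const
      fun x hx => Or.inl (hpos x hx).ne')).neg
  · rcases le_total 0 p with hp | hp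
    · exact Or.inr fun x hx => neg_nonpos.2 (mul_nonneg hp (Real.rpow_nonneg (hpos x hx).le _))
    · exact Or.inl fun x hx => neg_nonneg.2
        (mul_nonpos_of_nonpos_of_nonneg hp (Real.rpow_nonneg (hpos x hx).le _))

lemma bu_PB (ν : ℝ) : ∃ C : ℝ, 0 < C ∧ ∀ ω s c : ℝ, 0 < ω → ω⁻¹ ≤ s → s ≤ c →
    PB (fun x => bu ν (ω * x)) s c (C * ω⁻¹) := by
  obtain ⟨C, hC, hb⟩ := bu_integral_bounded ν
  refine ⟨C, hC, fun ω s c hω hs hsc => ⟨?_, fun t ht => ?_⟩⟩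
  · have hs0 : 0 < s := (inv_pos.2 hω).trans_le hs
    apply ContinuousOn.intervalIntegrable
    rw [uIcc_of_le hsc]
    exact (bu_continuousOn ν).comp (by fun_prop) fun x hx => mul_pos hω (hs0.trans_le hx.1)
  · rw [intervalIntegral.integral_comp_mul_left _ hω.ne', smul_eq_mul, abs_mul,
      abs_of_pos (inv_pos.2 hω), mul_comm]
    refine mul_le_mul_of_nonneg_right (hb _ _ ?_ ?_) (inv_pos.2 hω).le
    · have := mul_le_mul_of_nonneg_left hs hω.le
      rwa [mul_inv_cancel₀ hω.ne'] at this
    · exact mul_le_mul_of_nonneg_left ht.1 hω.le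

lemma core_bound (ν α β b : ℝ) (hαν : -1 < α + ν) (hβ : -1 < β) (hb : 0 < b) :
    ∃ C : ℝ, 0 < C ∧ ∀ ω : ℝ, 1 ≤ ω → ω⁻¹ ≤ b / 2 →
      PB (fun x => bu ν (ω * x) * x ^ (α - 1 / 2) * (b - x) ^ β) 0 b
        (C * (ω ^ (-α - 1 / 2) + ω ^ (-1 : ℝ) + ω ^ (-β - 1))) := by
  obtain ⟨C0, hC0, hPB⟩ := bu_PB ν
  obtain ⟨M, hM, hMb⟩ := bu_bounded ν
  obtain ⟨K, hK, hKb⟩ := bu_small ν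
  have hb2 : 0 < b / 2 := by positivity
  set Lβ : ℝ := (b / 2) ^ β with hLβ
  set Kβ : ℝ := (b / 2) ^ β + b ^ β with hKβ
  set L : ℝ := (b / 2) ^ (α - 1 / 2) with hL
  set N : ℝ := (b / 2) ^ (α - 1 / 2) + b ^ (α - 1 / 2) with hN
  have hLβ0 : 0 < Lβ := Real.rpow_pos_of_pos hb2 _
  have hL0 : 0 < L := Real.rpow_pos_of_pos hb2 _
  have hKβ0 : 0 < Kβ := add_pos hLβ0 (Real.rpow_pos_of_pos hb _)
  have hN0 : 0 < N := add_pos hL0 (Real.rpow_pos_of_pos hb _)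
  have hαν1 : 0 < α + ν + 1 := by linarith
  have hβ1 : 0 < β + 1 := by linarith
  set c1 : ℝ := K * Kβ / (α + ν + 1) with hc1
  set c2 : ℝ := 18 * C0 * Kβ with hc2
  set c3 : ℝ := 18 * C0 * N with hc3
  set c4 : ℝ := M * N / (β + 1) with hc4
  have hc10 : 0 < c1 := by positivity
  have hc20 : 0 < c2 := by positivity
  have hc30 : 0 < c3 := by positivity
  have hc40 : 0 < c4 := by positivity
  refine ⟨c1 + c2 + c2 * L + c3 + c3 * Lβ + c4, by positivity, fun ω hω1 hωb => ?_⟩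
  have hω : 0 < ω := one_pos.trans_le hω1
  have hωi : 0 < ω⁻¹ := inv_pos.2 hω
  set h : ℝ → ℝ := fun x => bu ν (ω * x) * x ^ (α - 1 / 2) * (b - x) ^ β with hh
  set A := ω ^ (-α - 1 / 2) with hA
  set D := ω ^ (-1 : ℝ) with hD
  set E := ω ^ (-β - 1) with hE
  have hA0 : 0 < A := Real.rpow_pos_of_pos hω _
  have hD0 : 0 < D := Real.rpow_pos_of_pos hω _
  have hE0 : 0 < E := Real.rpow_pos_of_pos hω _
  have hDinv : ω⁻¹ = D := by rw [hD, Real.rpow_neg_one]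
  have hcont : ContinuousOn h (Ioo 0 b) := by
    refine ContinuousOn.mul (ContinuousOn.mul ?_ ?_) ?_
    · exact (bu_continuousOn ν).comp (by fun_prop) fun x hx => mul_pos hω hx.1
    · exact continuousOn_id.rpow_const fun x hx => Or.inl hx.1.ne'
    · exact (continuousOn_const.sub continuousOn_id).rpow_const fun x hx =>
        Or.inl (sub_pos.2 hx.2).ne'
  have invpow : ∀ p : ℝ, (ω⁻¹) ^ p = ω ^ (-p) := fun p => by
    rw [Real.inv_rpow hω.le, Real.rpow_neg hω.le]
  -- piece 1
  have P1 : PB h 0 ω⁻¹ (c1 * A) := by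
    refine PB.of_le (h := fun x => (K * Kβ * ω ^ (ν + 1 / 2)) * x ^ (α + ν)) hωi.le
      (hcont.mono (Ioo_subset_Ioo le_rfl (by linarith))) ?_ ?_ ?_
    · exact (intervalIntegral.intervalIntegrable_rpow' hαν).const_mul _
    · intro x hx
      have hx0 : 0 < x := hx.1
      have hxb : x ≤ b / 2 := hx.2.le.trans hωb
      have h1 : ω * x ≤ 1 := by
        have := mul_le_mul_of_nonneg_left hx.2.le hω.le
        rwa [mul_inv_cancel₀ hω.ne'] at this
      have e1 := hKb (ω * x) (mul_pos hω hx0) h1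
      have e2 : |(b - x) ^ β| ≤ Kβ := rpow_le_ends hb2 (by linarith) (by linarith)
      simp only [hh]
      rw [abs_mul, abs_mul, abs_of_pos (Real.rpow_pos_of_pos hx0 (α - 1 / 2))]
      calc |bu ν (ω * x)| * x ^ (α - 1 / 2) * |(b - x) ^ β|
          ≤ (K * (ω * x) ^ (ν + 1 / 2)) * x ^ (α - 1 / 2) * Kβ := by gcongr
        _ = (K * Kβ * ω ^ (ν + 1 / 2)) * (x ^ (ν + 1 / 2) * x ^ (α - 1 / 2)) := by
            rw [Real.mul_rpow hω.le hx0.le]; ring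
        _ = _ := by
            rw [← Real.rpow_add hx0]; congr 2; ring
    · rw [intervalIntegral.integral_const_mul, integral_rpow (Or.inl hαν),
        Real.zero_rpow hαν1.ne', sub_zero, invpow]
      apply le_of_eq
      have e : A = ω ^ (ν + 1 / 2) * ω ^ (-(α + ν + 1)) := by
        rw [← Real.rpow_add hω, hA]; congr 1; ring
      rw [hc1, e]
      ring
  -- piece 2
  have P2 : PB h ω⁻¹ (b / 2) (c2 * (A + L * D)) := by
    have q := ((hPB ω ω⁻¹ (b / 2) hω le_rfl hωb).mul_rpow hωi hωb (α - 1 / 2)).mul_rpow_sub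
      (b := b) (by linarith) hωb β
    refine q.mono_bound ?_
    rw [show b - b / 2 = b / 2 by ring, invpow]
    have e1 : (b - ω⁻¹) ^ β ≤ Kβ :=
      (le_abs_self _).trans (rpow_le_ends hb2 (by linarith) (by linarith))
    have e2 : (b / 2) ^ β ≤ Kβ :=
      (le_abs_self _).trans (rpow_le_ends hb2 (by linarith) (by linarith))
    have e3 : ω ^ (-(α - 1 / 2)) * D = A := by
      rw [hD, ← Real.rpow_add hω, hA]; congr 1; ring
    rw [hDinv] at e1 ⊢
    have hq : 0 < ω ^ (-(α - 1 / 2)) := Real.rpow_pos_of_pos hω _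
    calc 3 * ((b / 2) ^ β + (b - D) ^ β) *
          (3 * (ω ^ (-(α - 1 / 2)) + (b / 2) ^ (α - 1 / 2)) * (C0 * D))
        ≤ 3 * (Kβ + Kβ) * (3 * (ω ^ (-(α - 1 / 2)) + (b / 2) ^ (α - 1 / 2)) * (C0 * D)) := by
          gcongr
      _ = c2 * (ω ^ (-(α - 1 / 2)) * D + L * D) := by rw [hc2, hL]; ring
      _ = _ := by rw [e3]
  have P3 : PB h (b / 2) (b - ω⁻¹) (c3 * (E + Lβ * D)) := by
    have hle : b / 2 ≤ b - ω⁻¹ := by linarith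
    have q := ((hPB ω (b / 2) (b - ω⁻¹) hω hωb hle).mul_rpow hb2 hle (α - 1 / 2)).mul_rpow_sub
      (b := b) (by linarith) hle β
    refine q.mono_bound ?_
    rw [show b - b / 2 = b / 2 by ring, sub_sub_cancel, invpow]
    have e1 : (b - ω⁻¹) ^ (α - 1 / 2) ≤ N :=
      (le_abs_self _).trans (rpow_le_ends hb2 (by linarith) (by linarith))
    have e2 : (b / 2) ^ (α - 1 / 2) ≤ N :=
      (le_abs_self _).trans (rpow_le_ends hb2 (by linarith) (by linarith))
    have e3 : ω ^ (-β) * D = E := by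
      rw [hD, ← Real.rpow_add hω, hE]; congr 1
    rw [hDinv] at e1 ⊢
    have hq : 0 < ω ^ (-β) := Real.rpow_pos_of_pos hω _
    calc 3 * (ω ^ (-β) + (b / 2) ^ β) *
          (3 * ((b / 2) ^ (α - 1 / 2) + (b - D) ^ (α - 1 / 2)) * (C0 * D))
        ≤ 3 * (ω ^ (-β) + (b / 2) ^ β) * (3 * (N + N) * (C0 * D)) := by
          gcongr
      _ = c3 * (ω ^ (-β) * D + Lβ * D) := by rw [hc3, hLβ]; ring
      _ = _ := by rw [e3]
  have P4 : PB h (b - ω⁻¹) b (c4 * E) := by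
    refine PB.of_le (h := fun x => (M * N) * (b - x) ^ β) (by linarith)
      (hcont.mono (Ioo_subset_Ioo (by linarith) le_rfl)) ?_ ?_ ?_
    · have := (intervalIntegral.intervalIntegrable_rpow' (a := ω⁻¹) (b := 0) hβ).comp_sub_left b
      simp only [sub_zero] at this
      exact this.const_mul _
    · intro x hx
      have hxb : b / 2 ≤ x := by linarith [hx.1]
      have hx0 : 0 < x := by linarith
      have h1 : 1 ≤ ω * x := by
        have := mul_le_mul_of_nonneg_left (hωb.trans hxb) hω.le
        rwa [mul_inv_cancel₀ hω.ne'] at this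
      have e1 := (hMb (ω * x) h1).1
      have e2 : |x ^ (α - 1 / 2)| ≤ N := rpow_le_ends hb2 hxb hx.2.le
      simp only [hh]
      rw [abs_mul, abs_mul, abs_of_nonneg (Real.rpow_nonneg (sub_pos.2 hx.2).le β)]
      have := Real.rpow_nonneg (sub_pos.2 hx.2).le β
      gcongr
    · rw [intervalIntegral.integral_const_mul,
        intervalIntegral.integral_comp_sub_left (fun x => x ^ β) b, sub_self, sub_sub_cancel,
        integral_rpow (Or.inl hβ), Real.zero_rpow hβ1.ne', sub_zero, invpow]
      apply le_of_eq
      rw [hc4, hE, show -β - 1 = -(β + 1) by ring]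
      ring
  have P := ((P1.trans hωi.le hωb P2).trans hb2.le (by linarith) P3).trans
    (by linarith) (by linarith) P4
  refine P.mono_bound ?_
  have : 0 ≤ c1 * (D + E) + c2 * (D + E) + c2 * L * (A + E) + c3 * (A + D) + c3 * Lβ * (A + E)
    + c4 * (A + D) := by positivity
  nlinarith

lemma wac_sup {b : ℝ} (hb : 0 < b) {ψ : ℝ → ℝ} (h : IsWAC 0 b ψ) :
    IntervalIntegrable (deriv ψ) volume 0 b ∧ |ψ b| + ∫ t in (0:ℝ)..b, |deriv ψ t| ≤ wacNorm 0 b ψ := by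
  have hi : IntervalIntegrable (deriv ψ) volume 0 b :=
    (intervalIntegrable_iff_integrableOn_Ioo_of_le hb.le).2 h.1
  refine ⟨hi, ?_⟩
  have hc : ContinuousOn ψ (Icc 0 b) := by
    have h1 : ContinuousOn (fun x => ∫ t in (0:ℝ)..x, deriv ψ t) (uIcc 0 b) :=
      (hi.absolutelyContinuousOnInterval_intervalIntegral left_mem_uIcc).continuousOn
    rw [uIcc_of_le hb.le] at h1
    exact (continuousOn_const.add h1).congr h.2
  obtain ⟨K, hK⟩ := isCompact_Icc.exists_bound_of_continuousOn hc
  have hbdd : BddAbove (Set.range fun x : Set.Icc (0:ℝ) b => |ψ (x : ℝ)|) := by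
    refine ⟨K, ?_⟩
    rintro _ ⟨x, rfl⟩
    exact hK x x.2
  have := le_ciSup hbdd ⟨b, hb.le, le_rfl⟩
  unfold wacNorm
  exact add_le_add this le_rfl

theorem van_der_corput_bessel_zero (ν α β b : ℝ) (hαν : -1 < α + ν) (hβ : -1 < β)
    (hb : 0 < b) :
    ∃ C : ℝ, 0 < C ∧ ∃ ω₀ : ℝ, 0 < ω₀ ∧
      ∀ ψ : ℝ → ℝ, IsWAC 0 b ψ → ∀ ω : ℝ, ω₀ ≤ ω →
        |∫ x in (0 : ℝ)..b, x ^ α * (b - x) ^ β * besselJ ν (ω * x) * ψ x| ≤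
          C * wacNorm 0 b ψ * ω ^ (-(min (α + 1) (min (β + 3 / 2) (3 / 2)))) := by
  obtain ⟨C, hC, hcore⟩ := core_bound ν α β b hαν hβ hb
  set c0 : ℝ := (1 / 2 : ℝ) ^ ν with hc0
  have hc00 : 0 < c0 := Real.rpow_pos_of_pos (by norm_num) _
  refine ⟨3 * c0 * C, by positivity, max 1 (2 / b), by positivity, fun ψ hψ ω hω0 => ?_⟩
  have hω1 : 1 ≤ ω := (le_max_left _ _).trans hω0
  have hω : 0 < ω := one_pos.trans_le hω1
  have hωb : ω⁻¹ ≤ b / 2 := by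
    have := (le_max_right _ _).trans hω0
    have h2 := inv_anti₀ (by positivity) this
    rwa [inv_div] at h2
  set m := min (α + 1) (min (β + 3 / 2) (3 / 2)) with hm
  have hm1 : m ≤ α + 1 := min_le_left _ _
  have hm2 : m ≤ β + 3 / 2 := (min_le_right _ _).trans (min_le_left _ _)
  have hm3 : m ≤ 3 / 2 := (min_le_right _ _).trans (min_le_right _ _)
  have hP := (hcore ω hω1 hωb).const_mul (c0 * ω ^ (-(1 / 2) : ℝ))
  have hw0 : 0 < ω ^ (-(1 / 2) : ℝ) := Real.rpow_pos_of_pos hω _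
  have hPf : PB (fun x => x ^ α * (b - x) ^ β * besselJ ν (ω * x)) 0 b
      (3 * c0 * C * ω ^ (-m)) := by
    refine PB.mono_bound (PB.congr hb.le hP ?_) ?_
    · intro x hx
      have hx0 : 0 < x := hx.1
      have e : x ^ (α - 1 / 2) = x ^ α * x ^ (-(1 / 2) : ℝ) := by
        rw [← Real.rpow_add hx0]; congr 1
      rw [besselJ_eq_bu ν _ (mul_pos hω hx0), Real.mul_rpow hω.le hx0.le, e]
      ring
    · rw [abs_of_pos (by positivity)]
      have f1 : ω ^ (-(1 / 2) : ℝ) * ω ^ (-α - 1 / 2) ≤ ω ^ (-m) := by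
        rw [← Real.rpow_add hω]; exact Real.rpow_le_rpow_of_exponent_le hω1 (by linarith)
      have f2 : ω ^ (-(1 / 2) : ℝ) * ω ^ (-1 : ℝ) ≤ ω ^ (-m) := by
        rw [← Real.rpow_add hω]; exact Real.rpow_le_rpow_of_exponent_le hω1 (by linarith)
      have f3 : ω ^ (-(1 / 2) : ℝ) * ω ^ (-β - 1) ≤ ω ^ (-m) := by
        rw [← Real.rpow_add hω]; exact Real.rpow_le_rpow_of_exponent_le hω1 (by linarith)
      have hcc : 0 < c0 * C := by positivity
      calc _ = c0 * C * (ω ^ (-(1 / 2) : ℝ) * ω ^ (-α - 1 / 2) +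
            ω ^ (-(1 / 2) : ℝ) * ω ^ (-1 : ℝ) + ω ^ (-(1 / 2) : ℝ) * ω ^ (-β - 1)) := by ring
        _ ≤ c0 * C * (ω ^ (-m) + ω ^ (-m) + ω ^ (-m)) := by gcongr
        _ = _ := by ring
  obtain ⟨hi, hn⟩ := wac_sup hb hψ
  refine (hPf.vdc hb.le hi hψ.2).trans ?_
  have hp : 0 < 3 * c0 * C * ω ^ (-m) := by
    have := Real.rpow_pos_of_pos hω (-m); positivity
  calc _ ≤ 3 * c0 * C * ω ^ (-m) * wacNorm 0 b ψ := mul_le_mul_of_nonneg_left hn hp.le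
    _ = _ := by ring
end
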